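/- arXiv:2004.05058 — 2 statements merged into one kernel-verified Lean document; each statement's English description precedes it below -/
import Mathlib

section
/- Every classical normal set A ⊆ ℕ contains, for every n ∈ ℕ, a geo-arithmetic configuration of the form {b·(a+i·d)^j : 0 ≤ i, j ≤ n}: there exist a, b, d ∈ ℕ such that b·(a+i·d)^j ∈ A for all integers i, j with 0 ≤ i, j ≤ n. -/
open Filter

/- `A ⊆ ℕ` is a classical normal set. -/
open scoped Classical in
def ClassicalNormalSet (A : Set ℕ) : Prop :=
  ∀ K : Finset ℕ, K.Nonempty → (∀ k ∈ K, 0 < k) → ∀ B : ℕ → Bool,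
    Tendsto
      (fun n =>
        (((Finset.Icc 1 n).filter (fun m => ∀ k ∈ K, (k + m ∈ A ↔ B k = true))).card : ℝ) / n)
      atTop (nhds ((1 / 2 : ℝ) ^ K.card))


namespace GeoArith
open Combinatorics

/-- Real-valued indicator of a proposition. -/
noncomputable def ind (p : Prop) : ℝ := by
  classical exact if p then 1 else 0

lemma ind_pos {p : Prop} (h : p) : ind p = 1 := by simp [ind, h]
lemma ind_neg {p : Prop} (h : ¬ p) : ind p = 0 := by simp [ind, h]
lemma ind_nonneg (p : Prop) : 0 ≤ ind p := by
  by_cases h : p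
  · rw [ind_pos h]; norm_num
  · rw [ind_neg h]
lemma ind_le_one (p : Prop) : ind p ≤ 1 := by
  by_cases h : p
  · rw [ind_pos h]
  · rw [ind_neg h]; norm_num
lemma ind_mono {p q : Prop} (h : p → q) : ind p ≤ ind q := by
  by_cases hp : p
  · rw [ind_pos hp, ind_pos (h hp)]
  · rw [ind_neg hp]; exact ind_nonneg q
lemma ind_not (p : Prop) : ind (¬ p) = 1 - ind p := by
  by_cases h : p
  · rw [ind_pos h, ind_neg (not_not.2 h)]; norm_num
  · rw [ind_neg h, ind_pos h]; norm_num

/-- Glue two words along a splitting of the coordinate set. -/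
def glue {α ι σ τ : Type} (e : ι ≃ σ ⊕ τ) (x : σ → α) (y : τ → α) : ι → α :=
  fun i => Sum.elim x y (e i)

/-- Gluing as an equivalence. -/
def glueEquiv {α ι σ τ : Type} (e : ι ≃ σ ⊕ τ) : (σ → α) × (τ → α) ≃ (ι → α) where
  toFun p := glue e p.1 p.2
  invFun w := (fun s => w (e.symm (Sum.inl s)), fun t => w (e.symm (Sum.inr t)))
  left_inv p := by ext <;> simp [glue]
  right_inv w := by
    ext i
    have hi := e.symm_apply_apply i
    rcases h : e i with s | t
    · rw [h] at hi; simp [glue, h, hi]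
    · rw [h] at hi; simp [glue, h, hi]

lemma sum_glue {α ι σ τ : Type} [Fintype α] [Fintype ι] [Fintype σ] [Fintype τ]
    [DecidableEq ι] [DecidableEq σ] [DecidableEq τ] (e : ι ≃ σ ⊕ τ) (F : (ι → α) → ℝ) :
    ∑ w, F w = ∑ x : σ → α, ∑ y : τ → α, F (glue e x y) := by
  rw [← Equiv.sum_comp (glueEquiv e) F, Fintype.sum_prod_type]
  rfl

/-- Composition of combinatorial subspaces. -/
def scomp {η θ α ι : Type} (V : Subspace η α ι) (U : Subspace θ α η) : Subspace θ α ι where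
  idxFun i := (V.idxFun i).elim Sum.inl U.idxFun
  proper t := by
    obtain ⟨e, he⟩ := U.proper t
    obtain ⟨i, hi⟩ := V.proper e
    exact ⟨i, by simp [hi, he]⟩

lemma scomp_apply {η θ α ι : Type} (V : Subspace η α ι) (U : Subspace θ α η) (z : θ → α) :
    scomp V U z = V (U z) := by
  ext i
  rw [Subspace.apply_def, Subspace.apply_def]
  rcases h : V.idxFun i with a | e <;> simp [scomp, h, Subspace.apply_def]

/-- A subspace on the left part, with the right part frozen. -/
def sleft {η α ι σ τ : Type} (e : ι ≃ σ ⊕ τ) (V : Subspace η α σ) (y : τ → α) :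
    Subspace η α ι where
  idxFun i := Sum.elim V.idxFun (fun t => Sum.inl (y t)) (e i)
  proper t := by
    obtain ⟨s, hs⟩ := V.proper t
    exact ⟨e.symm (Sum.inl s), by simp [hs]⟩

lemma sleft_apply {η α ι σ τ : Type} (e : ι ≃ σ ⊕ τ) (V : Subspace η α σ) (y : τ → α)
    (z : η → α) : sleft e V y z = glue e (V z) y := by
  ext i
  rw [Subspace.apply_def]
  rcases h : e i with a | b <;> simp [sleft, glue, h, Subspace.apply_def]

/-- Freeze the left part. -/
def sright {α ι σ τ : Type} (e : ι ≃ σ ⊕ τ) (x : σ → α) : Subspace τ α ι where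
  idxFun i := Sum.elim (fun s => Sum.inl (x s)) Sum.inr (e i)
  proper t := ⟨e.symm (Sum.inr t), by simp⟩

lemma sright_apply {α ι σ τ : Type} (e : ι ≃ σ ⊕ τ) (x : σ → α)
    (z : τ → α) : sright e x z = glue e x z := by
  ext i
  rw [Subspace.apply_def]
  rcases h : e i with a | b <;> simp [sright, glue, h]

/-- Sets without combinatorial lines. -/
def LineFree {α ι : Type} (A : (ι → α) → Prop) : Prop := ∀ l : Line α ι, ¬ ∀ x, A (l x)

lemma LineFree.sub {α ι η : Type} {A : (ι → α) → Prop} (h : LineFree A) (V : Subspace η α ι) :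
    LineFree (fun z => A (V z)) := by
  intro l hl
  let l' : Line α ι :=
    { idxFun := fun i => (V.idxFun i).elim some l.idxFun
      proper := by
        obtain ⟨e, he⟩ := l.proper
        obtain ⟨i, hi⟩ := V.proper e
        exact ⟨i, by simp [hi, he]⟩ }
  refine h l' fun x => ?_
  have : l' x = V (l x) := by
    ext i
    rw [Subspace.apply_def, Line.coe_apply]
    rcases h : V.idxFun i with a | e <;> simp [l', h]
  rw [this]; exact hl x

/-- The density Hales-Jewett property for the alphabet `α`. -/
def DHJ (α : Type) [Fintype α] : Prop :=
  ∀ δ : ℝ, 0 < δ → ∃ n : ℕ, ∀ (ι : Type) [Fintype ι] [DecidableEq ι], n ≤ Fintype.card ι →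
    ∀ A : (ι → α) → Prop,
      δ * (Fintype.card α : ℝ) ^ Fintype.card ι ≤ ∑ x, ind (A x) → ∃ l : Line α ι, ∀ x, A (l x)

lemma card_words (α ι : Type) [Fintype α] [Fintype ι] [DecidableEq ι] :
    (Fintype.card (ι → α) : ℝ) = (Fintype.card α : ℝ) ^ Fintype.card ι := by
  simp

lemma exists_split {ι : Type} [Fintype ι] (n : ℕ) (h : n ≤ Fintype.card ι) :
    Nonempty (ι ≃ Fin n ⊕ Fin (Fintype.card ι - n)) := by
  refine ⟨Fintype.equivOfCardEq ?_⟩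
  simp; omega

lemma pigeon_line {α : Type} [Fintype α] [Nonempty α] {n : ℕ} {δ : ℝ} (hδ : 0 < δ)
    (hn : ∀ A : (Fin n → α) → Prop,
      δ * (Fintype.card α : ℝ) ^ n ≤ ∑ x, ind (A x) → ∃ l : Line α (Fin n), ∀ x, A (l x))
    {Ω : Type} [Fintype Ω] [Nonempty Ω] (B : (Fin n → α) → Ω → Prop)
    (h : 2 * δ * (Fintype.card α : ℝ) ^ n * Fintype.card Ω ≤ ∑ ω, ∑ x, ind (B x ω)) :
    ∃ l : Line α (Fin n),
      δ / Fintype.card (Fin n → Option α) * Fintype.card Ω ≤ ∑ ω, ind (∀ x, B (l x) ω) := by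
  classical
  set N : ℝ := (Fintype.card α : ℝ) ^ n with hN
  have hNpos : 0 < N := by
    have : 0 < Fintype.card α := Fintype.card_pos
    positivity
  have hΩ : (0 : ℝ) < Fintype.card Ω := by exact_mod_cast Fintype.card_pos
  have hL : (0 : ℝ) < Fintype.card (Fin n → Option α) := by exact_mod_cast Fintype.card_pos
  let Y : (Fin n → Option α) → Ω → Prop :=
    fun f ω => ∃ l : Line α (Fin n), l.idxFun = f ∧ ∀ x, B (l x) ω
  have key : ∀ ω, ∑ x, ind (B x ω) ≤ N * ∑ f, ind (Y f ω) + δ * N := by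
    intro ω
    have hYn : 0 ≤ ∑ f, ind (Y f ω) := Finset.sum_nonneg fun f _ => ind_nonneg _
    by_cases hg : δ * N ≤ ∑ x, ind (B x ω)
    · obtain ⟨l, hl⟩ := hn (fun x => B x ω) hg
      have h1 : (1 : ℝ) ≤ ∑ f, ind (Y f ω) := by
        have := Finset.single_le_sum (f := fun f => ind (Y f ω)) (fun f _ => ind_nonneg _)
          (Finset.mem_univ l.idxFun)
        rw [ind_pos (p := Y l.idxFun ω) ⟨l, rfl, hl⟩] at this
        exact this
      have h2 : ∑ x, ind (B x ω) ≤ N := by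
        calc ∑ x, ind (B x ω) ≤ ∑ _x : Fin n → α, (1 : ℝ) :=
              Finset.sum_le_sum fun x _ => ind_le_one _
          _ = N := by simp [hN]
      nlinarith [mul_pos hδ hNpos]
    · push Not at hg
      nlinarith [mul_nonneg hNpos.le hYn]
  have tot : δ * Fintype.card Ω ≤ ∑ f, ∑ ω, ind (Y f ω) := by
    have := h.trans (Finset.sum_le_sum fun ω _ => key ω)
    rw [Finset.sum_add_distrib, ← Finset.mul_sum, Finset.sum_comm] at this
    simp only [Finset.sum_const, Finset.card_univ, nsmul_eq_mul] at this
    have h3 : N * (δ * Fintype.card Ω) ≤ N * ∑ f, ∑ ω, ind (Y f ω) := by linarith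
    exact le_of_mul_le_mul_left h3 hNpos
  obtain ⟨f, -, hf⟩ : ∃ f ∈ (Finset.univ : Finset (Fin n → Option α)),
      δ / Fintype.card (Fin n → Option α) * Fintype.card Ω ≤ ∑ ω, ind (Y f ω) := by
    apply Finset.exists_le_of_sum_le Finset.univ_nonempty
    refine le_trans (le_of_eq ?_) tot
    simp only [Finset.sum_const, Finset.card_univ, nsmul_eq_mul]
    field_simp
  have hpos : 0 < ∑ ω, ind (Y f ω) := lt_of_lt_of_le (by positivity) hf
  obtain ⟨ω, -, hω⟩ := Finset.exists_ne_zero_of_sum_ne_zero hpos.ne'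
  have hY : Y f ω := by
    by_contra hc
    exact hω (ind_neg hc)
  obtain ⟨l, rfl, -⟩ := hY
  refine ⟨l, hf.trans (Finset.sum_le_sum fun ω _ => ind_mono ?_)⟩
  rintro ⟨l', hl', hB⟩
  rw [show l = l' from Line.ext hl'.symm]
  exact hB

/-- Multidimensional density Hales-Jewett. -/
lemma mdhj {α : Type} [Fintype α] [Nonempty α] (h : DHJ α) (d : ℕ) :
    ∀ δ : ℝ, 0 < δ → ∃ n : ℕ, ∀ (ι : Type) [Fintype ι] [DecidableEq ι], n ≤ Fintype.card ι →
    ∀ A : (ι → α) → Prop,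
      δ * (Fintype.card α : ℝ) ^ Fintype.card ι ≤ ∑ x, ind (A x) →
        ∃ V : Subspace (Fin d) α ι, ∀ z, A (V z) := by
  have hc : (0 : ℝ) < Fintype.card α := by exact_mod_cast Fintype.card_pos
  induction d with
  | zero =>
    intro δ hδ
    refine ⟨0, fun ι _ _ _ A hA => ?_⟩
    have hpos : 0 < ∑ x, ind (A x) := lt_of_lt_of_le (by positivity) hA
    obtain ⟨x, -, hx⟩ := Finset.exists_ne_zero_of_sum_ne_zero hpos.ne'
    have hx : A x := by
      by_contra hc
      exact hx (ind_neg hc)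
    refine ⟨⟨fun i => Sum.inl (x i), fun e => e.elim0⟩, fun z => ?_⟩
    exact hx
  | succ d ih =>
    intro δ hδ
    obtain ⟨n₁, hn₁⟩ := h (δ / 2) (by positivity)
    have hL : (0 : ℝ) < Fintype.card (Fin n₁ → Option α) := by exact_mod_cast Fintype.card_pos
    obtain ⟨n₂, hn₂⟩ := ih (δ / 2 / Fintype.card (Fin n₁ → Option α)) (by positivity)
    refine ⟨n₁ + n₂, fun ι _ _ hι A hA => ?_⟩
    obtain ⟨e⟩ := exists_split (ι := ι) n₁ (by omega)
    set r := Fintype.card ι - n₁ with hr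
    have hn₁' := hn₁ (Fin n₁) (by simp)
    simp only [Fintype.card_fin] at hn₁'
    have := pigeon_line (Ω := Fin r → α) (by positivity) hn₁' (fun x y => A (glue e x y)) (by
      rw [Finset.sum_comm, ← sum_glue e (fun w => ind (A w)), card_words, Fintype.card_fin]
      refine le_trans (le_of_eq ?_) hA
      rw [show Fintype.card ι = n₁ + r by omega, pow_add]
      ring)
    obtain ⟨l, hl⟩ := this
    rw [card_words α (Fin r)] at hl
    obtain ⟨V, hV⟩ := hn₂ (Fin r) (by simp; omega) _ hl
    refine ⟨⟨fun i => Sum.elim (fun s => (l.idxFun s).elim (Sum.inr 0) Sum.inl)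
      (fun t => (V.idxFun t).map id Fin.succ) (e i), ?_⟩, fun z => ?_⟩
    · intro j
      refine Fin.cases ?_ (fun j => ?_) j
      · obtain ⟨s, hs⟩ := l.proper
        exact ⟨e.symm (Sum.inl s), by simp [hs]⟩
      · obtain ⟨s, hs⟩ := V.proper j
        exact ⟨e.symm (Sum.inr s), by simp [hs]⟩
    · have := hV (fun j => z j.succ) (z 0)
      convert this using 1
      ext i
      rw [Subspace.apply_def]
      rcases h : e i with a | b
      · rcases h' : l.idxFun a with _ | c <;> simp [glue, h, h']
      · rcases h' : V.idxFun b with _ | c <;> simp [glue, h, h', Subspace.apply_def]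

end GeoArith


namespace GeoArith
open Combinatorics

/-- Sets that do not distinguish the letter `none` from the letter `some i`. -/
def Insens {κ ι : Type} (i : κ) (D : (ι → Option κ) → Prop) : Prop :=
  ∀ x y : ι → Option κ, (∀ t, (x t).getD i = (y t).getD i) → D x → D y

lemma Insens.compl {κ ι : Type} {i : κ} {D : (ι → Option κ) → Prop} (h : Insens i D) :
    Insens i (fun x => ¬ D x) :=
  fun x y hxy hx hy => hx (h y x (fun t => (hxy t).symm) hy)

lemma Insens.sub {κ ι η : Type} {i : κ} {D : (ι → Option κ) → Prop} (h : Insens i D)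
    (V : Subspace η (Option κ) ι) : Insens i (fun x => D (V x)) := by
  intro x y hxy hx
  refine h _ _ (fun t => ?_) hx
  rw [Subspace.apply_def, Subspace.apply_def]
  rcases V.idxFun t with a | e
  · simp
  · simpa using hxy e

/-- The word with letters `u` on `T`, and `none` outside. -/
def extT {κ ι : Type} (T : Finset ι) [DecidableEq ι] (u : T → κ) : ι → Option κ :=
  fun t => if h : t ∈ T then some (u ⟨t, h⟩) else none

/-- Words over `Option κ` are pairs of a support and a word over `κ`. -/
noncomputable def extEquiv (κ ι : Type) [Fintype ι] [DecidableEq ι] :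
    (Σ T : Finset ι, (T → κ)) ≃ (ι → Option κ) := by
  classical
  refine Equiv.ofBijective (fun p => extT p.1 p.2) ⟨?_, ?_⟩
  · rintro ⟨T, u⟩ ⟨T', u'⟩ h
    simp only at h
    have hT : T = T' := by
      ext t
      have := congrFun h t
      by_cases h1 : t ∈ T <;> by_cases h2 : t ∈ T' <;> simp_all [extT]
    subst hT
    congr 1
    ext t
    have := congrFun h t
    simpa [extT] using this
  · intro w
    refine ⟨⟨Finset.univ.filter (fun t => (w t).isSome), fun t => (w t.1).get (Finset.mem_filter.1 t.2).2⟩, ?_⟩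
    ext1 t
    by_cases h : (w t).isSome
    · simp [extT, h]
    · simp only [extT, Finset.mem_filter, Finset.mem_univ, true_and, h]
      simp at h
      simp [h]

lemma sum_ext {κ ι : Type} [Fintype κ] [Fintype ι] [DecidableEq ι] (F : (ι → Option κ) → ℝ) :
    ∑ w, F w = ∑ T : Finset ι, ∑ u : T → κ, F (extT T u) := by
  rw [← Equiv.sum_comp (extEquiv κ ι) F, Fintype.sum_sigma]
  rfl

lemma card_option_real (κ : Type) [Fintype κ] :
    (Fintype.card (Option κ) : ℝ) = Fintype.card κ + 1 := by
  simp

/-- Few words have small support. -/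
lemma small_support {κ ι : Type} [Fintype κ] [Fintype ι] [DecidableEq ι] (l : ℕ) :
    ∑ T : Finset ι, ind (T.card < l) * (Fintype.card κ : ℝ) ^ T.card ≤
      2 ^ l * (Fintype.card κ / 2 + 1 : ℝ) ^ Fintype.card ι := by
  have h1 := Finset.sum_pow_mul_eq_add_pow ((Fintype.card κ : ℝ) / 2) 1 (Finset.univ : Finset ι)
  rw [Finset.card_univ] at h1
  rw [← h1, Finset.powerset_univ, Finset.mul_sum]
  refine Finset.sum_le_sum fun T _ => ?_
  rw [one_pow, mul_one, div_pow]
  have hk : (0 : ℝ) ≤ (Fintype.card κ : ℝ) ^ T.card := by positivity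
  by_cases h : T.card < l
  · rw [ind_pos h, one_mul, mul_div_assoc', le_div_iff₀ (by positivity), mul_comm]
    exact mul_le_mul_of_nonneg_right (pow_le_pow_right₀ (by norm_num) h.le) hk
  · rw [ind_neg h, zero_mul]
    positivity

lemma exists_pow_small {a b c : ℝ} (ha : 0 ≤ a) (hab : a < b) (hc : 0 < c) :
    ∃ n : ℕ, ∀ m, n ≤ m → a ^ m ≤ c * b ^ m := by
  have hb : 0 < b := lt_of_le_of_lt ha hab
  have h1 : a / b < 1 := by rwa [div_lt_one hb]
  have h0 : 0 ≤ a / b := by positivity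
  obtain ⟨n, hn⟩ := exists_pow_lt_of_lt_one hc h1
  refine ⟨n, fun m hm => ?_⟩
  have := (pow_le_pow_of_le_one h0 h1.le hm).trans hn.le
  rwa [div_pow, div_le_iff₀ (by positivity)] at this

/-- A dense insensitive set contains a subspace. -/
lemma insens_subspace {κ : Type} [Fintype κ] [Nonempty κ] (h : DHJ κ) (d : ℕ) (η : ℝ)
    (hη : 0 < η) : ∃ n : ℕ, ∀ (ι : Type) [Fintype ι] [DecidableEq ι], n ≤ Fintype.card ι →
      ∀ (i : κ) (E : (ι → Option κ) → Prop), Insens i E →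
      η * (Fintype.card (Option κ) : ℝ) ^ Fintype.card ι ≤ ∑ x, ind (E x) →
        ∃ V : Subspace (Fin d) (Option κ) ι, ∀ z, E (V z) := by
  obtain ⟨l, hl⟩ := mdhj h d (η / 2) (by positivity)
  have hk : (0 : ℝ) < Fintype.card κ := by exact_mod_cast Fintype.card_pos
  obtain ⟨n, hn⟩ := exists_pow_small (a := (Fintype.card κ : ℝ) / 2 + 1)
    (b := Fintype.card κ + 1) (c := η / 4 / 2 ^ l) (by positivity) (by linarith) (by positivity)
  refine ⟨n, fun ι _ _ hι i E hE hd => ?_⟩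
  rw [card_option_real] at hd
  have hsmall := (small_support (κ := κ) (ι := ι) l).trans
    (mul_le_mul_of_nonneg_left (hn _ hι) (by positivity))
  have htot : ∑ T : Finset ι, (Fintype.card κ : ℝ) ^ T.card
      = (Fintype.card κ + 1 : ℝ) ^ Fintype.card ι := by
    have h1 := Finset.sum_pow_mul_eq_add_pow (Fintype.card κ : ℝ) 1 (Finset.univ : Finset ι)
    rw [Finset.card_univ, Finset.powerset_univ] at h1
    simpa using h1
  have hP : 0 < (Fintype.card κ + 1 : ℝ) ^ Fintype.card ι := by positivity
  have hex : ∃ T : Finset ι, l ≤ T.card ∧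
      η / 2 * (Fintype.card κ : ℝ) ^ T.card ≤ ∑ u : T → κ, ind (E (extT T u)) := by
    by_contra hcon
    push Not at hcon
    rw [sum_ext] at hd
    have hb : ∀ T : Finset ι, ∑ u : T → κ, ind (E (extT T u)) ≤
        ind (T.card < l) * (Fintype.card κ : ℝ) ^ T.card
          + η / 2 * (Fintype.card κ : ℝ) ^ T.card := by
      intro T
      by_cases hT : T.card < l
      · rw [ind_pos hT, one_mul]
        have : ∑ u : T → κ, ind (E (extT T u)) ≤ (Fintype.card κ : ℝ) ^ T.card := by
          calc ∑ u : T → κ, ind (E (extT T u)) ≤ ∑ _u : T → κ, (1 : ℝ) :=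
                Finset.sum_le_sum fun x _ => ind_le_one _
            _ = _ := by simp
        have h2 : 0 ≤ η / 2 * (Fintype.card κ : ℝ) ^ T.card := by positivity
        linarith
      · rw [ind_neg hT, zero_mul, zero_add]
        exact (hcon T (by omega)).le
    have h3 := hd.trans (Finset.sum_le_sum fun T _ => hb T)
    rw [Finset.sum_add_distrib, ← Finset.mul_sum, htot] at h3
    have h4 : (2 : ℝ) ^ l * (η / 4 / 2 ^ l * (Fintype.card κ + 1 : ℝ) ^ Fintype.card ι)
      = η / 4 * (Fintype.card κ + 1 : ℝ) ^ Fintype.card ι := by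
      field_simp
    rw [h4] at hsmall
    nlinarith [mul_pos hη hP]
  obtain ⟨T, hTl, hT⟩ := hex
  obtain ⟨U, hU⟩ := hl T (by simpa using hTl) (fun u => E (extT T u)) (by simpa using hT)
  refine ⟨⟨fun t => if h : t ∈ T then (U.idxFun ⟨t, h⟩).map some id else Sum.inl none, ?_⟩,
    fun z => ?_⟩
  · intro e
    obtain ⟨t, ht⟩ := U.proper e
    exact ⟨t.1, by simp [ht]⟩
  · refine hE _ _ (fun t => ?_) (hU (fun e => (z e).getD i))
    rw [Subspace.apply_def]
    by_cases ht : t ∈ T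
    · rcases hx : U.idxFun ⟨t, ht⟩ with a | e <;> simp [extT, ht, hx, Subspace.apply_def]
    · simp [extT, ht]

/-- All `d`-dimensional subspace sums of `g` are nonpositive. -/
def SubNonpos {α ι : Type} [Fintype α] (d : ℕ) (g : (ι → α) → ℝ) : Prop :=
  ∀ V : Subspace (Fin d) α ι, ∑ z, g (V z) ≤ 0

lemma SubNonpos.sub {α ι η : Type} [Fintype α] {d : ℕ} {g : (ι → α) → ℝ} (h : SubNonpos d g)
    (V : Subspace η α ι) : SubNonpos d (fun z => g (V z)) := by
  intro U
  have := h (scomp V U)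
  simpa only [scomp_apply] using this

lemma subspace_inj {α ι : Type} {d : ℕ} (V : Subspace (Fin d) α ι) : Function.Injective V := by
  intro x y h
  ext e
  obtain ⟨i, hi⟩ := V.proper e
  have := congrFun h i
  simpa [Subspace.apply_def, hi] using this

/-- Sums over a single insensitive set, iterated form. -/
lemma insens_iter {κ : Type} [Fintype κ] {d N₀ : ℕ} {η : ℝ} (hη : 0 < η) (i : κ)
    (hN₀ : ∀ E : (Fin N₀ → Option κ) → Prop, Insens i E →
      η * (Fintype.card (Option κ) : ℝ) ^ N₀ ≤ ∑ x, ind (E x) →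
        ∃ V : Subspace (Fin d) (Option κ) (Fin N₀), ∀ z, E (V z)) (s : ℕ) :
    ∀ (ι : Type) [Fintype ι] [DecidableEq ι], N₀ * s ≤ Fintype.card ι →
      ∀ (g : (ι → Option κ) → ℝ), (∀ x, g x ≤ 1) → SubNonpos d g →
      ∀ D : (ι → Option κ) → Prop, Insens i D →
      ∑ x, ind (D x) * g x ≤
        (1 - (1 - 1 / (Fintype.card (Option κ) : ℝ) ^ N₀) ^ s) * η *
          (Fintype.card (Option κ) : ℝ) ^ Fintype.card ι
        + (1 - 1 / (Fintype.card (Option κ) : ℝ) ^ N₀) ^ s * ∑ x, ind (D x) := by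
  classical
  set q : ℝ := (Fintype.card (Option κ) : ℝ) with hq
  have hq1 : 1 ≤ q := by rw [hq, card_option_real]; simp
  have hqN : 1 ≤ q ^ N₀ := one_le_pow₀ hq1
  set c : ℝ := 1 / q ^ N₀ with hc
  have hc0 : 0 < c := by positivity
  have hc1 : c ≤ 1 := by rw [hc, div_le_one (by positivity)]; exact hqN
  have hcq : c * q ^ N₀ = 1 := by rw [hc]; field_simp
  induction s with
  | zero =>
    intro ι _ _ _ g hg _ D _
    simp only [pow_zero, sub_self, zero_mul, zero_add, one_mul]
    refine Finset.sum_le_sum fun x _ => ?_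
    nlinarith [hg x, ind_nonneg (D x)]
  | succ s ih =>
    intro ι _ _ hι g hg hgs D hD
    rw [Nat.mul_succ] at hι
    obtain ⟨e⟩ := exists_split (ι := ι) N₀ (by omega)
    set r := Fintype.card ι - N₀ with hr
    -- good second parts
    let sec : (Fin r → Option κ) → (Fin N₀ → Option κ) → Prop := fun y x => D (glue e x y)
    let R : ((Fin N₀ → Option κ) → Prop) → (Fin N₀ → Option κ) → Prop := fun E =>
      if h : ∃ V : Subspace (Fin d) (Option κ) (Fin N₀), ∀ z, E (V z) then
        fun x => ∃ z, h.choose z = x else fun _ => False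
    have hRsub : ∀ E x, R E x → E x := by
      intro E x hx
      by_cases h : ∃ V : Subspace (Fin d) (Option κ) (Fin N₀), ∀ z, E (V z)
      · simp only [R, dif_pos h] at hx
        obtain ⟨z, rfl⟩ := hx
        exact h.choose_spec z
      · simp only [R, dif_neg h] at hx
    have hsecI : ∀ y, Insens i (sec y) := by
      intro y x x' hx
      refine hD _ _ fun t => ?_
      rcases ht : e t with a | b
      · simpa [glue, ht] using hx a
      · simp [glue, ht]
    have hseceq : ∀ y y', (∀ t, (y t).getD i = (y' t).getD i) → sec y = sec y' := by
      intro y y' hy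
      ext x
      constructor
      · refine hD _ _ fun t => ?_
        rcases ht : e t with a | b
        · simp [glue, ht]
        · simpa [glue, ht] using hy b
      · refine hD _ _ fun t => ?_
        rcases ht : e t with a | b
        · simp [glue, ht]
        · simpa [glue, ht] using (hy b).symm
    -- sum over the removed part is nonpositive
    have hremg : ∀ y, ∑ x, ind (R (sec y) x) * g (glue e x y) ≤ 0 := by
      intro y
      by_cases h : ∃ V : Subspace (Fin d) (Option κ) (Fin N₀), ∀ z, sec y (V z)
      · have hR : ∀ x, R (sec y) x ↔ ∃ z, h.choose z = x := by
          intro x; simp only [R, dif_pos h]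
        have := hgs (sleft e h.choose y)
        simp only [sleft_apply] at this
        refine le_trans (le_of_eq ?_) this
        have himg := Finset.sum_image (s := (Finset.univ : Finset (Fin d → Option κ)))
          (g := fun z => h.choose z) (f := fun x => g (glue e x y))
          (fun a _ b _ hab => subspace_inj _ hab)
        rw [← himg, ← Finset.sum_filter_add_sum_filter_not Finset.univ (fun x => R (sec y) x)]
        have z2 : ∑ x with ¬ R (sec y) x, ind (R (sec y) x) * g (glue e x y) = 0 := by
          refine Finset.sum_eq_zero fun x hx => ?_
          rw [ind_neg (Finset.mem_filter.1 hx).2, zero_mul]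
        rw [z2, add_zero]
        refine Finset.sum_congr ?_ fun x hx => ?_
        · ext x; simp [hR]
        · have : R (sec y) x := by
            rw [hR]; simpa using hx
          rw [ind_pos this, one_mul]
      · refine le_of_eq (Finset.sum_eq_zero fun x _ => ?_)
        have : ¬ R (sec y) x := by simp only [R, dif_neg h]; exact id
        rw [ind_neg this, zero_mul]
    -- the removed part is large when the section is large
    have hremc : ∀ y, c * (∑ x, ind (sec y x) - η * q ^ N₀) ≤ ∑ x, ind (R (sec y) x) := by
      intro y
      have hn : 0 ≤ ∑ x, ind (R (sec y) x) := Finset.sum_nonneg fun _ _ => ind_nonneg _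
      by_cases hy : η * q ^ N₀ ≤ ∑ x, ind (sec y x)
      · have h := hN₀ (sec y) (hsecI y) hy
        have h1 : (1 : ℝ) ≤ ∑ x, ind (R (sec y) x) := by
          have := Finset.single_le_sum (f := fun x => ind (R (sec y) x))
            (fun f _ => ind_nonneg _) (Finset.mem_univ (h.choose fun _ => none))
          rw [ind_pos (p := R (sec y) _)] at this
          · exact this
          · simp only [R, dif_pos h]; exact ⟨_, rfl⟩
        have h2 : ∑ x, ind (sec y x) ≤ q ^ N₀ := by
          calc ∑ x, ind (sec y x) ≤ ∑ _x : Fin N₀ → Option κ, (1 : ℝ) :=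
                Finset.sum_le_sum fun x _ => ind_le_one _
            _ = _ := by simp [hq]
        have h3 : 0 < η * q ^ N₀ := by positivity
        nlinarith
      · push Not at hy
        nlinarith
    let D' : (Fin N₀ → Option κ) → (Fin r → Option κ) → Prop :=
      fun x y => sec y x ∧ ¬ R (sec y) x
    have hindD : ∀ x y, ind (D (glue e x y)) = ind (D' x y) + ind (R (sec y) x) := by
      intro x y
      by_cases h1 : R (sec y) x
      · rw [ind_pos h1, ind_pos (p := D (glue e x y)) (hRsub _ _ h1),
          ind_neg (p := D' x y) (fun h => h.2 h1)]; norm_num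
      · rw [ind_neg h1, add_zero]
        by_cases h2 : D (glue e x y)
        · rw [ind_pos h2, ind_pos (p := D' x y) ⟨h2, h1⟩]
        · rw [ind_neg h2, ind_neg (p := D' x y) (fun h => h2 h.1)]
    have hD'I : ∀ x, Insens i (D' x) := by
      intro x y y' hy h
      have := hseceq y y' hy
      simp only [D', ← this]
      exact h
    have hih : ∀ x, _ := fun x => ih (Fin r) (by simp; omega) (fun y => g (glue e x y))
      (fun y => hg _) (by
        have := hgs.sub (sright e x)
        simpa only [sright_apply] using this) (D' x) (hD'I x)
    simp only [Fintype.card_fin] at hih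
    have hsum := Finset.sum_le_sum fun x (_ : x ∈ (Finset.univ : Finset (Fin N₀ → Option κ))) =>
      hih x
    rw [Finset.sum_add_distrib] at hsum
    simp only [Finset.sum_const, Finset.card_univ, nsmul_eq_mul] at hsum
    rw [card_words, ← hq, Fintype.card_fin, ← Finset.mul_sum] at hsum
    have hqq : q ^ Fintype.card ι = q ^ N₀ * q ^ r := by
      rw [← pow_add]; congr 1; omega
    rw [hqq, sum_glue e, sum_glue e]
    have e1 : ∑ x, ∑ y, ind (D (glue e x y)) * g (glue e x y)
        ≤ ∑ x, ∑ y, ind (D' x y) * g (glue e x y) := by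
      have : ∑ x, ∑ y, ind (D (glue e x y)) * g (glue e x y) =
        ∑ x, ∑ y, ind (D' x y) * g (glue e x y)
          + ∑ y, ∑ x, ind (R (sec y) x) * g (glue e x y) := by
        rw [Finset.sum_comm (γ := Fin r → Option κ) (f := fun y x => ind (R (sec y) x) * g (glue e x y)),
          ← Finset.sum_add_distrib]
        refine Finset.sum_congr rfl fun x _ => ?_
        rw [← Finset.sum_add_distrib]
        refine Finset.sum_congr rfl fun y _ => ?_
        rw [hindD, add_mul]
      have h0 : ∑ y, ∑ x, ind (R (sec y) x) * g (glue e x y) ≤ 0 :=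
        Finset.sum_nonpos fun y _ => hremg y
      linarith
    have e2 : ∑ x, ∑ y, ind (D (glue e x y)) = ∑ x, ∑ y, ind (D' x y)
        + ∑ y, ∑ x, ind (R (sec y) x) := by
      rw [Finset.sum_comm (γ := Fin r → Option κ) (f := fun y x => ind (R (sec y) x)),
          ← Finset.sum_add_distrib]
      refine Finset.sum_congr rfl fun x _ => ?_
      rw [← Finset.sum_add_distrib]
      refine Finset.sum_congr rfl fun y _ => ?_
      rw [hindD]
    have e3 : c * (∑ x, ∑ y, ind (D (glue e x y)) - η * (q ^ N₀ * q ^ r))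
        ≤ ∑ y, ∑ x, ind (R (sec y) x) := by
      have := Finset.sum_le_sum fun y (_ : y ∈ (Finset.univ : Finset (Fin r → Option κ))) =>
        hremc y
      rw [← Finset.mul_sum, Finset.sum_sub_distrib] at this
      simp only [Finset.sum_const, Finset.card_univ, nsmul_eq_mul] at this
      rw [card_words, ← hq, Fintype.card_fin, Finset.sum_comm] at this
      simp only [sec] at this ⊢
      calc _ = _ := by ring
        _ ≤ _ := this
    set X := ∑ x, ∑ y, ind (D (glue e x y)) with hX
    set X' := ∑ x, ∑ y, ind (D' x y) with hX'
    set Z := ∑ y, ∑ x, ind (R (sec y) x) with hZ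
    have hp : 0 ≤ (1 - c) ^ s := pow_nonneg (by linarith) s
    have h5 : X' ≤ (1 - c) * X + c * η * (q ^ N₀ * q ^ r) := by linarith
    have h6 := mul_le_mul_of_nonneg_left h5 hp
    rw [pow_succ]
    refine e1.trans (hsum.trans ?_)
    nlinarith

/-- Sums over a single insensitive set. -/
lemma insens_single {κ : Type} [Fintype κ] [Nonempty κ] (h : DHJ κ) (d : ℕ) (η : ℝ)
    (hη : 0 < η) : ∃ n : ℕ, ∀ (ι : Type) [Fintype ι] [DecidableEq ι], n ≤ Fintype.card ι →
      ∀ (i : κ) (g : (ι → Option κ) → ℝ), (∀ x, g x ≤ 1) → SubNonpos d g →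
      ∀ D : (ι → Option κ) → Prop, Insens i D →
      ∑ x, ind (D x) * g x ≤ η * (Fintype.card (Option κ) : ℝ) ^ Fintype.card ι := by
  obtain ⟨N₀, hN₀⟩ := insens_subspace h d (η / 2) (by positivity)
  have hN₀' := hN₀ (Fin N₀) (by simp)
  simp only [Fintype.card_fin] at hN₀'
  set q : ℝ := (Fintype.card (Option κ) : ℝ) with hq
  have hq1 : 1 ≤ q := by rw [hq, card_option_real]; simp
  have hqN : 1 ≤ q ^ N₀ := one_le_pow₀ hq1
  have hc1 : 1 / q ^ N₀ ≤ 1 := by rw [div_le_one (by positivity)]; exact hqN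
  have hc0 : 0 < 1 / q ^ N₀ := by positivity
  obtain ⟨s, hs⟩ := exists_pow_lt_of_lt_one (y := 1 - 1 / q ^ N₀) (half_pos hη) (by linarith)
  refine ⟨N₀ * s, fun ι _ _ hι i g hg hgs D hD => ?_⟩
  have := insens_iter (half_pos hη) i (hN₀' i) s ι hι g hg hgs D hD
  rw [← hq] at this
  have hp : 0 ≤ (1 - 1 / q ^ N₀) ^ s := pow_nonneg (by linarith) s
  have h2 : ∑ x, ind (D x) ≤ q ^ Fintype.card ι := by
    calc ∑ x, ind (D x) ≤ ∑ _x : ι → Option κ, (1 : ℝ) :=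
          Finset.sum_le_sum fun x _ => ind_le_one _
      _ = _ := by simp [hq]
  have hQ : 0 < q ^ Fintype.card ι := by positivity
  have h0 : 0 ≤ ∑ x, ind (D x) := Finset.sum_nonneg fun _ _ => ind_nonneg _
  have h3 : (1 - 1 / q ^ N₀) ^ s * ∑ x, ind (D x) ≤ η / 2 * q ^ Fintype.card ι :=
    mul_le_mul hs.le h2 h0 (by positivity)
  have h4 : (1 - (1 - 1 / q ^ N₀) ^ s) * (η / 2) * q ^ Fintype.card ι
      ≤ 1 * (η / 2) * q ^ Fintype.card ι := by gcongr; linarith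
  linarith

/-- Sums over a union of insensitive sets. -/
lemma insens_union {κ : Type} [Fintype κ] [Nonempty κ] [DecidableEq κ] (h : DHJ κ) (d : ℕ)
    (S : Finset κ) :
    ∀ η : ℝ, 0 < η → ∃ n : ℕ, ∀ (ι : Type) [Fintype ι] [DecidableEq ι], n ≤ Fintype.card ι →
      ∀ (g : (ι → Option κ) → ℝ), (∀ x, g x ≤ 1) → SubNonpos d g →
      ∀ D : κ → (ι → Option κ) → Prop, (∀ i, Insens i (D i)) →
      ∑ x, ind (∃ i ∈ S, D i x) * g x ≤ η * (Fintype.card (Option κ) : ℝ) ^ Fintype.card ι := by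
  induction S using Finset.induction_on with
  | empty =>
    intro η hη
    refine ⟨0, fun ι _ _ _ g _ _ D _ => ?_⟩
    have : ∀ x, ind (∃ i ∈ (∅ : Finset κ), D i x) * g x = 0 := by
      intro x; rw [ind_neg (by simp), zero_mul]
    simp only [this, Finset.sum_const_zero]
    positivity
  | insert a S ha ih =>
    intro η hη
    obtain ⟨d', hd'⟩ := ih (η / 3) (by positivity)
    obtain ⟨n₁, hn₁⟩ := insens_single h d (η / 3) (by positivity)
    obtain ⟨n₂, hn₂⟩ := insens_single h d' (η / 3) (by positivity)
    refine ⟨max n₁ n₂, fun ι _ _ hι g hg hgs D hD => ?_⟩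
    have h1 := hn₁ ι ((le_max_left _ _).trans hι) a g hg hgs (D a) (hD a)
    have h2 := hn₂ ι ((le_max_right _ _).trans hι) a
      (fun x => ind (∃ i ∈ S, D i x) * g x - η / 3) (by
        intro x
        have := ind_le_one (∃ i ∈ S, D i x)
        have := ind_nonneg (∃ i ∈ S, D i x)
        nlinarith [hg x]) (by
        intro V
        rw [Finset.sum_sub_distrib]
        have := hd' (Fin d') (by simp) (fun z => g (V z)) (fun z => hg _) (hgs.sub V)
          (fun i z => D i (V z)) (fun i => (hD i).sub V)
        simp only [Fintype.card_fin] at this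
        simp only [Finset.sum_const, Finset.card_univ, nsmul_eq_mul]
        rw [card_words, Fintype.card_fin]
        linarith) (fun x => ¬ D a x) (hD a).compl
    set q : ℝ := (Fintype.card (Option κ) : ℝ) with hq
    have h3 : ∑ x, ind (∃ i ∈ insert a S, D i x) * g x =
        ∑ x, ind (D a x) * g x
        + (∑ x, ind (¬ D a x) * (ind (∃ i ∈ S, D i x) * g x - η / 3)
        + η / 3 * ∑ x, ind (¬ D a x)) := by
      rw [Finset.mul_sum, ← Finset.sum_add_distrib, ← Finset.sum_add_distrib]
      refine Finset.sum_congr rfl fun x _ => ?_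
      by_cases hx : D a x
      · rw [ind_pos hx, ind_neg (not_not.2 hx), ind_pos ⟨a, Finset.mem_insert_self _ _, hx⟩]
        ring
      · rw [ind_neg hx, ind_pos hx]
        have : (∃ i ∈ insert a S, D i x) ↔ (∃ i ∈ S, D i x) := by simp [hx]
        simp only [this]
        ring
    have h4 : ∑ x, ind (¬ D a x) ≤ q ^ Fintype.card ι := by
      calc ∑ x, ind (¬ D a x) ≤ ∑ _x : ι → Option κ, (1 : ℝ) :=
            Finset.sum_le_sum fun x _ => ind_le_one _
        _ = _ := by simp [hq]
    rw [h3]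
    nlinarith

end GeoArith


namespace GeoArith
open Combinatorics

/-- The identity subspace. -/
def sid (α ι : Type) : Subspace ι α ι := ⟨Sum.inr, fun i => ⟨i, rfl⟩⟩

lemma sid_apply (α ι : Type) (z : ι → α) : sid α ι z = z := rfl

/-- Line-free sets have density at most `β` in large dimension. -/
def Good (α : Type) [Fintype α] (β : ℝ) : Prop :=
  ∃ n : ℕ, ∀ (ι : Type) [Fintype ι] [DecidableEq ι], n ≤ Fintype.card ι →
    ∀ A : (ι → α) → Prop, LineFree A →
      ∑ x, ind (A x) ≤ β * (Fintype.card α : ℝ) ^ Fintype.card ι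

lemma no_none_count {κ W : Type} [Fintype κ] [Fintype W] [DecidableEq W] :
    ∑ z : W → Option κ, ind (∀ t, z t ≠ none) ≤ (Fintype.card κ : ℝ) ^ Fintype.card W := by
  classical
  have h1 : ∑ z : W → Option κ, ind (∀ t, z t ≠ none)
      = ((Finset.univ.filter (fun z : W → Option κ => ∀ t, z t ≠ none)).card : ℝ) := by
    rw [Finset.card_filter]
    push_cast
    refine Finset.sum_congr rfl fun z _ => ?_
    unfold ind
    congr
  have h2 : (Finset.univ.filter (fun z : W → Option κ => ∀ t, z t ≠ none)) ⊆
      (Finset.univ : Finset (W → κ)).image (fun u t => some (u t)) := by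
    intro z hz
    have hz' := (Finset.mem_filter.1 hz).2
    rw [Finset.mem_image]
    refine ⟨fun t => (z t).get (Option.isSome_iff_ne_none.2 (hz' t)), Finset.mem_univ _, ?_⟩
    ext1 t
    simp
  rw [h1, ← card_words]
  exact_mod_cast (Finset.card_le_card h2).trans Finset.card_image_le

/-- The heart of one section: few points of a line-free set. -/
lemma section_bound {κ W : Type} [Fintype κ] [Fintype W] [DecidableEq W]
    {δ ε τ : ℝ} {d : ℕ}
    (hd : ∀ A : (Fin d → Option κ) → Prop, LineFree A →
      ∑ x, ind (A x) ≤ (δ + ε) * (Fintype.card (Option κ) : ℝ) ^ d)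
    (hδ : 0 ≤ δ + ε)
    (hU : ∀ (g : (W → Option κ) → ℝ), (∀ x, g x ≤ 1) → SubNonpos d g →
      ∀ D : κ → (W → Option κ) → Prop, (∀ i, Insens i (D i)) →
      ∑ x, ind (∃ i ∈ (Finset.univ : Finset κ), D i x) * g x ≤
        τ * (Fintype.card (Option κ) : ℝ) ^ Fintype.card W)
    (A : (W → Option κ) → Prop) (hA : LineFree A) :
    ∑ z, ind (A z) ≤ (Fintype.card κ : ℝ) ^ Fintype.card W
      + τ * (Fintype.card (Option κ) : ℝ) ^ Fintype.card W
      + (δ + ε) * ((Fintype.card (Option κ) : ℝ) ^ Fintype.card W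
        - ∑ z : W → Option κ, ind (∀ i, A (fun t => some ((z t).getD i)))) := by
  classical
  let D : κ → (W → Option κ) → Prop := fun i z => ¬ A (fun t => some ((z t).getD i))
  have h1 := hU (fun z => ind (A z) - (δ + ε))
    (fun z => by linarith [ind_le_one (A z)])
    (by
      intro V
      rw [Finset.sum_sub_distrib]
      simp only [Finset.sum_const, Finset.card_univ, nsmul_eq_mul]
      rw [card_words, Fintype.card_fin]
      have := hd _ (hA.sub V)
      linarith) D
    (by
      intro i x y hxy hx
      have : (fun t => some ((x t).getD i)) = fun t => some ((y t).getD i) := by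
        ext1 t; rw [hxy t]
      simp only [D, ← this]
      exact hx)
  have h2 : ∀ z : W → Option κ, ind (A z) ≤ ind (∀ t, z t ≠ none)
      + ind (∃ i ∈ (Finset.univ : Finset κ), D i z) * (ind (A z) - (δ + ε))
      + (δ + ε) * (1 - ind (∀ i, A (fun t => some ((z t).getD i)))) := by
    intro z
    by_cases hC : ∀ i, A (fun t => some ((z t).getD i))
    · rw [ind_neg (p := ∃ i ∈ (Finset.univ : Finset κ), D i z)
        (by rintro ⟨i, -, hi⟩; exact hi (hC i)), ind_pos hC]
      have : ind (A z) ≤ ind (∀ t, z t ≠ none) := by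
        refine ind_mono fun hz t ht => ?_
        let l : Line (Option κ) W := ⟨fun t => (z t).map some, ⟨t, by simp [ht]⟩⟩
        refine hA l fun x => ?_
        rcases x with _ | i
        · convert hz using 1
          ext1 s
          rcases hs : z s with _ | a <;> simp [l, hs]
        · convert hC i using 1
          ext1 s
          rcases hs : z s with _ | a <;> simp [l, hs]
      linarith
    · rw [ind_pos (p := ∃ i ∈ (Finset.univ : Finset κ), D i z)
        (by push Not at hC; obtain ⟨i, hi⟩ := hC; exact ⟨i, Finset.mem_univ _, hi⟩), ind_neg hC]
      have := ind_nonneg (∀ t, z t ≠ none)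
      linarith
  have h3 := Finset.sum_le_sum fun z (_ : z ∈ (Finset.univ : Finset (W → Option κ))) => h2 z
  rw [Finset.sum_add_distrib, Finset.sum_add_distrib, ← Finset.mul_sum,
    Finset.sum_sub_distrib] at h3
  simp only [Finset.sum_const, Finset.card_univ, nsmul_eq_mul, mul_one] at h3
  rw [card_words] at h3
  have h4 := no_none_count (κ := κ) (W := W)
  linarith

set_option maxHeartbeats 4000000 in
lemma core {κ : Type} [Fintype κ] [Nonempty κ] (h : DHJ κ) {δ : ℝ} (hδ : 0 < δ) (hδ1 : δ ≤ 1)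
    (hG : ∀ ε : ℝ, 0 < ε → Good (Option κ) (δ + ε))
    (hB : ∀ ε : ℝ, 0 < ε → ε ≤ δ → ¬ Good (Option κ) (δ - ε)) : False := by
  classical
  obtain ⟨l, hl⟩ := h (δ / 4) (by positivity)
  have hl' := hl (Fin l) (by simp)
  simp only [Fintype.card_fin] at hl'
  set L : ℝ := (Fintype.card (Fin l → Option κ) : ℝ) with hL
  have hL1 : 1 ≤ L := by rw [hL]; exact_mod_cast Fintype.card_pos
  set θ : ℝ := δ / 4 / L with hθ
  have hθ0 : 0 < θ := by positivity
  have hθ1 : θ ≤ 1 := by rw [hθ, div_le_one (by positivity)]; linarith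
  set ε' : ℝ := δ * θ / 8 with hε'
  have hε'0 : 0 < ε' := by positivity
  have hε'δ : ε' ≤ δ / 2 := by rw [hε']; nlinarith
  obtain ⟨d, hd⟩ := hG ε' hε'0
  have hd' := hd (Fin d) (by simp)
  simp only [Fintype.card_fin] at hd'
  obtain ⟨m₀, hm₀⟩ := insens_union h d (Finset.univ : Finset κ) ε' hε'0
  obtain ⟨m₁, hm₁⟩ := exists_pow_small (a := (Fintype.card κ : ℝ)) (b := Fintype.card κ + 1)
    (c := ε') (by positivity) (by linarith) hε'0
  rw [← card_option_real] at hm₁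
  set q : ℝ := (Fintype.card (Option κ) : ℝ) with hq
  have hq1 : 1 ≤ q := by rw [hq, card_option_real]; simp
  set m := max m₀ m₁ with hm
  set U : ℝ := q ^ (l * m) with hU
  have hU1 : 1 ≤ U := one_le_pow₀ hq1
  set ε : ℝ := ε' / (2 * U) with hε
  have hε0 : 0 < ε := by positivity
  have hεU : 2 * ε * U = ε' := by rw [hε]; field_simp
  have hεδ : ε ≤ δ := by nlinarith
  obtain ⟨n₂, hn₂⟩ := hG ε hε0
  have hbad := hB ε hε0 hεδ
  unfold Good at hbad
  push Not at hbad
  obtain ⟨ι, _, _, hι, A, hA, hAc⟩ := hbad (l * m + n₂)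
  rw [← hq] at hAc
  set r := Fintype.card ι - l * m with hr
  obtain ⟨e⟩ : Nonempty (ι ≃ (Fin l × Fin m) ⊕ Fin r) := by
    refine ⟨Fintype.equivOfCardEq ?_⟩
    simp; omega
  set R : ℝ := q ^ r with hR
  have hR0 : 0 < R := by positivity
  have hN : q ^ Fintype.card ι = U * R := by
    rw [hU, hR, ← pow_add]; congr 1; omega
  have hcardI : (Fintype.card (Fin l × Fin m → Option κ) : ℝ) = U := by
    rw [card_words, ← hq, hU]; simp
  -- every section is dense
  have hup : ∀ u : Fin l × Fin m → Option κ, ∑ y, ind (A (glue e u y)) ≤ (δ + ε) * R := by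
    intro u
    have := hn₂ (Fin r) (by simp; omega) _ (hA.sub (sright e u))
    simp only [sright_apply, Fintype.card_fin] at this
    exact this
  have hlow : ∀ u : Fin l × Fin m → Option κ, (δ - ε') * R ≤ ∑ y, ind (A (glue e u y)) := by
    intro u
    have h1 := Finset.single_le_sum (f := fun u : Fin l × Fin m → Option κ =>
      (δ + ε) * R - ∑ y, ind (A (glue e u y))) (fun u _ => sub_nonneg.2 (hup u))
      (Finset.mem_univ u)
    simp only [Finset.sum_sub_distrib, Finset.sum_const, Finset.card_univ, nsmul_eq_mul] at h1
    rw [hcardI, ← sum_glue e (fun w => ind (A w))] at h1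
    rw [hN] at hAc
    have h2 : 2 * ε * U * R = ε' * R := by rw [hεU]
    nlinarith [mul_pos hε0 hR0]
  -- find a line in the small cube
  let P : (Fin l → κ) → (Fin l × Fin m → Option κ) → (Fin l × Fin m → Option κ) :=
    fun x z p => some ((z p).getD (x p.1))
  obtain ⟨ℓ, hℓ⟩ := pigeon_line (Ω := (Fin l × Fin m → Option κ) × (Fin r → Option κ))
    (δ := δ / 4) (by positivity) hl' (fun x ω => A (glue e (P x ω.1) ω.2)) (by
      rw [Finset.sum_comm]
      have : ∀ x ∈ (Finset.univ : Finset (Fin l → κ)), U * ((δ - ε') * R) ≤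
          ∑ ω : (Fin l × Fin m → Option κ) × (Fin r → Option κ),
            ind (A (glue e (P x ω.1) ω.2)) := by
        intro x _
        rw [Fintype.sum_prod_type]
        have := Finset.sum_le_sum fun z
          (_ : z ∈ (Finset.univ : Finset (Fin l × Fin m → Option κ))) => hlow (P x z)
        simpa only [Finset.sum_const, Finset.card_univ, nsmul_eq_mul, hcardI] using this
      have h2 := Finset.sum_le_sum this
      simp only [Finset.sum_const, Finset.card_univ, nsmul_eq_mul] at h2
      refine le_trans ?_ h2
      rw [card_words, Fintype.card_prod, Nat.cast_mul, hcardI, card_words, ← hq,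
        Fintype.card_fin, Fintype.card_fin, ← hR]
      have hk : (0 : ℝ) ≤ (Fintype.card κ : ℝ) ^ l := by positivity
      have h3 : 2 * (δ / 4) * (U * R) ≤ U * ((δ - ε') * R) := by
        have : 0 < U * R := by positivity
        nlinarith
      calc _ = (Fintype.card κ : ℝ) ^ l * (2 * (δ / 4) * (U * R)) := by ring
        _ ≤ _ := mul_le_mul_of_nonneg_left h3 hk)
  rw [← hL, ← hθ, Fintype.card_prod, Nat.cast_mul, hcardI, card_words, ← hq, Fintype.card_fin,
    ← hR, Fintype.sum_prod_type] at hℓ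
  -- split according to the wildcard set
  let p : Fin l × Fin m → Prop := fun t => ℓ.idxFun t.1 = none
  let eI : Fin l × Fin m ≃ {t // p t} ⊕ {t // ¬ p t} := (Equiv.sumCompl p).symm
  have heI1 : ∀ t (ht : p t), eI t = Sum.inl ⟨t, ht⟩ := fun t ht =>
    Equiv.sumCompl_symm_apply_of_pos ht
  have heI2 : ∀ t (ht : ¬ p t), eI t = Sum.inr ⟨t, ht⟩ := fun t ht =>
    Equiv.sumCompl_symm_apply_of_neg ht
  obtain ⟨i₀⟩ := ‹Nonempty κ›
  let v : ({t // ¬ p t} → Option κ) → ({t // ¬ p t} → Option κ) :=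
    fun z t => some ((z t).getD (ℓ i₀ t.1.1))
  have hP : ∀ i z' z'', P (ℓ i) (glue eI z' z'')
      = glue eI (fun t => some ((z' t).getD i)) (v z'') := by
    intro i z' z''
    ext1 t
    by_cases ht : p t
    · have ht' : ℓ.idxFun t.1 = none := ht
      simp [P, glue, heI1 t ht, ht']
    · have ht' : ℓ.idxFun t.1 ≠ none := ht
      obtain ⟨a, ha⟩ := Option.ne_none_iff_exists'.1 ht'
      simp [P, glue, heI2 t ht, v, ha]
  have hWm : m ≤ Fintype.card {t // p t} := by
    obtain ⟨j, hj⟩ := ℓ.proper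
    have := Fintype.card_le_of_injective (fun s : Fin m => (⟨(j, s), hj⟩ : {t // p t}))
      (fun a b hab => by simpa using hab)
    simpa using this
  set W : ℝ := q ^ Fintype.card {t // p t} with hW
  have hW0 : 0 < W := by positivity
  have hkW := hm₁ _ ((le_max_right _ _).trans hWm)
  have hWW : U = W * (Fintype.card ({t // ¬ p t} → Option κ) : ℝ) := by
    rw [← hcardI, Fintype.card_congr (glueEquiv (α := Option κ) eI).symm, Fintype.card_prod,
      Nat.cast_mul, card_words (Option κ) {t // p t}]
  have hsec : ∀ z'' y, ∑ z', ind (A (glue e (glue eI z' (v z'')) y)) ≤ ε' * W + ε' * W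
      + (δ + ε') * (W - ∑ z', ind (∀ i, A (glue e (P (ℓ i) (glue eI z' z'')) y))) := by
    intro z'' y
    have hlf := hA.sub (sleft e (sleft eI (sid (Option κ) {t // p t}) (v z'')) y)
    simp only [sleft_apply, sid_apply] at hlf
    have := section_bound (τ := ε') hd' (by positivity)
      (hm₀ {t // p t} ((le_max_left _ _).trans hWm)) _ hlf
    rw [← hq, ← hW] at this
    simp only [hP]
    linarith
  have hsum := Finset.sum_le_sum fun z''
    (_ : z'' ∈ (Finset.univ : Finset ({t // ¬ p t} → Option κ))) =>
    Finset.sum_le_sum fun y (_ : y ∈ (Finset.univ : Finset (Fin r → Option κ))) => hsec z'' y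
  have hleft : U * ((δ - ε') * R) ≤
      ∑ z'', ∑ y, ∑ z', ind (A (glue e (glue eI z' (v z'')) y)) := by
    have h1 : ∀ z'' ∈ (Finset.univ : Finset ({t // ¬ p t} → Option κ)), W * ((δ - ε') * R) ≤
        ∑ y, ∑ z', ind (A (glue e (glue eI z' (v z'')) y)) := by
      intro z'' _
      rw [Finset.sum_comm]
      have := Finset.sum_le_sum fun z'
          (_ : z' ∈ (Finset.univ : Finset ({t // p t} → Option κ))) => hlow (glue eI z' (v z''))
      simp only [Finset.sum_const, Finset.card_univ, nsmul_eq_mul] at this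
      rwa [card_words, ← hq, ← hW] at this
    have h2 := Finset.sum_le_sum h1
    simp only [Finset.sum_const, Finset.card_univ, nsmul_eq_mul] at h2
    rw [hWW]
    linarith
  have hT : θ * (U * R) ≤
      ∑ z'', ∑ y, ∑ z', ind (∀ i, A (glue e (P (ℓ i) (glue eI z' z'')) y)) := by
    refine hℓ.trans (le_of_eq ?_)
    rw [sum_glue eI, Finset.sum_comm]
    refine Finset.sum_congr rfl fun z'' _ => ?_
    rw [Finset.sum_comm]
  simp only [Finset.sum_add_distrib, ← Finset.mul_sum, Finset.sum_sub_distrib, Finset.sum_const,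
    Finset.card_univ, nsmul_eq_mul] at hsum
  rw [card_words (Option κ) (Fin r), ← hq, Fintype.card_fin, ← hR] at hsum
  set T := ∑ z'', ∑ y, ∑ z', ind (∀ i, A (glue e (P (ℓ i) (glue eI z' z'')) y)) with hTdef
  set K : ℝ := (Fintype.card ({t // ¬ p t} → Option κ) : ℝ) with hK
  have hUR : 0 < U * R := by positivity
  have hfin : U * R * (δ - ε') ≤ 2 * ε' * (U * R) + (δ + ε') * (U * R - θ * (U * R)) := by
    have h1 : (δ + ε') * (U * R - T) ≤ (δ + ε') * (U * R - θ * (U * R)) := by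
      apply mul_le_mul_of_nonneg_left _ (by positivity)
      linarith
    have h2 := hleft.trans hsum
    have h3 : K * (R * W) = U * R := by rw [hWW]; ring
    nlinarith
  have hfin' : δ - ε' ≤ 2 * ε' + (δ + ε') * (1 - θ) := by
    refine le_of_mul_le_mul_left (a := U * R) ?_ hUR
    linarith
  have h8 : 8 * ε' = δ * θ := by rw [hε']; ring
  nlinarith [mul_pos hε'0 hθ0, mul_pos hδ hθ0]

lemma dhj_option {κ : Type} [Fintype κ] (h : DHJ κ) : DHJ (Option κ) := by
  classical
  rcases isEmpty_or_nonempty κ with hE | hE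
  · intro δ hδ
    refine ⟨1, fun ι _ _ hι A hA => ?_⟩
    have hpos : 0 < ∑ x, ind (A x) := lt_of_lt_of_le (by
      rw [card_option_real]; positivity) hA
    obtain ⟨x, -, hx⟩ := Finset.exists_ne_zero_of_sum_ne_zero hpos.ne'
    have hx : A x := by
      by_contra hc
      exact hx (ind_neg hc)
    have : Nonempty ι := Fintype.card_pos_iff.1 (by omega)
    refine ⟨Line.diagonal _ _, fun y => ?_⟩
    convert hx using 1
    ext1 t
    exact Subsingleton.elim _ _
  · set q : ℝ := (Fintype.card (Option κ) : ℝ) with hq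
    have hq0 : 0 < q := by rw [hq, card_option_real]; positivity
    have hmono : ∀ a b : ℝ, a ≤ b → Good (Option κ) a → Good (Option κ) b := by
      rintro a b hab ⟨n, hn⟩
      refine ⟨n, fun ι _ _ hι A hA => (hn ι hι A hA).trans ?_⟩
      rw [← hq]
      exact mul_le_mul_of_nonneg_right hab (by positivity)
    have h1 : Good (Option κ) 1 := by
      refine ⟨0, fun ι _ _ hι A hA => ?_⟩
      calc ∑ x, ind (A x) ≤ ∑ _x : ι → Option κ, (1 : ℝ) :=
            Finset.sum_le_sum fun x _ => ind_le_one _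
        _ = _ := by simp
    let S : Set ℝ := {β | 0 ≤ β ∧ Good (Option κ) β}
    have hSne : S.Nonempty := ⟨1, zero_le_one, h1⟩
    have hSb : BddBelow S := ⟨0, fun β hβ => hβ.1⟩
    have hS0 : 0 ≤ sInf S := le_csInf hSne fun β hβ => hβ.1
    have hgood : ∀ ε : ℝ, 0 < ε → Good (Option κ) (sInf S + ε) := by
      intro ε hε
      obtain ⟨β, hβ, hlt⟩ := exists_lt_of_csInf_lt hSne (lt_add_of_pos_right (sInf S) hε)
      exact hmono _ _ hlt.le hβ.2
    have hzero : sInf S = 0 := by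
      by_contra hne
      have hpos : 0 < sInf S := lt_of_le_of_ne hS0 (Ne.symm hne)
      refine core h hpos (csInf_le hSb ⟨zero_le_one, h1⟩) hgood fun ε hε hle hbad => ?_
      have := csInf_le hSb (show sInf S - ε ∈ S from ⟨by linarith, hbad⟩)
      linarith
    intro δ hδ
    obtain ⟨n, hn⟩ := hgood (δ / 2) (by positivity)
    rw [hzero, zero_add, ← hq] at hn
    refine ⟨n, fun ι _ _ hι A hA => ?_⟩
    by_contra hcon
    push Not at hcon
    have := hn ι hι A (fun l hl => by
      obtain ⟨x, hx⟩ := hcon l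
      exact hx (hl x))
    rw [← hq] at hA
    have hp : 0 < q ^ Fintype.card ι := by positivity
    nlinarith

lemma dhj_equiv {α β : Type} [Fintype α] [Fintype β] (e : α ≃ β) (h : DHJ α) : DHJ β := by
  classical
  intro δ hδ
  obtain ⟨n, hn⟩ := h δ hδ
  refine ⟨n, fun ι _ _ hι A hA => ?_⟩
  obtain ⟨l, hl⟩ := hn ι hι (fun x => A (fun t => e (x t))) (by
    rw [Fintype.card_congr e]
    refine hA.trans (le_of_eq ?_)
    rw [← Equiv.sum_comp (Equiv.arrowCongr (Equiv.refl ι) e)]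
    rfl)
  refine ⟨l.map e, fun x => ?_⟩
  have := hl (e.symm x)
  convert this using 1
  ext1 t
  rcases ht : l.idxFun t with _ | a <;> simp [Line.map, ht]

/-- The density Hales-Jewett theorem. -/
theorem dhj (k : ℕ) : DHJ (Fin k) := by
  induction k with
  | zero =>
    intro δ hδ
    refine ⟨1, fun ι _ _ hι A hA => ?_⟩
    have : Nonempty ι := Fintype.card_pos_iff.1 (by omega)
    exact ⟨Line.diagonal _ _, fun x => x.elim0⟩
  | succ k ih => exact dhj_equiv (finSuccEquiv k).symm (dhj_option ih)

end GeoArith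

namespace GeoArith
open Combinatorics

/-- Splitting a product along a line. -/
lemma sum_line {n N : ℕ} (l : Line (Fin (n + 1)) (Fin N)) :
    ∃ c d : ℕ, 0 < d ∧ ∀ j : Fin (n + 1), ∑ t, ((l j t : Fin (n + 1)) : ℕ) = c + j * d := by
  obtain ⟨t₀, ht₀⟩ := l.proper
  refine ⟨∑ t, (l.idxFun t).elim 0 (fun v => (v : ℕ)), ∑ t, (l.idxFun t).elim 1 (fun _ => 0),
    ?_, fun j => ?_⟩
  · refine Finset.sum_pos' (fun t _ => Nat.zero_le _) ⟨t₀, Finset.mem_univ _, ?_⟩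
    simp [ht₀]
  · rw [Finset.mul_sum, ← Finset.sum_add_distrib]
    refine Finset.sum_congr rfl fun t _ => ?_
    rcases ht : l.idxFun t with _ | v
    · rw [Line.apply_none _ _ _ ht]; simp
    · rw [Line.apply_some ht]; simp

/-- Szemeredi's theorem, finitary form. -/
lemma szemeredi (n : ℕ) {δ : ℝ} (hδ : 0 < δ) :
    ∃ M : ℕ, 0 < M ∧ ∀ S : ℕ → Prop, δ * M ≤ ∑ i ∈ Finset.range M, ind (S i) →
      ∃ i₀ d : ℕ, 0 < d ∧ ∀ i ≤ n, i₀ + i * d < M ∧ S (i₀ + i * d) := by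
  classical
  obtain ⟨N, hN⟩ := dhj (n + 1) (δ / 2) (by positivity)
  obtain ⟨M, hM⟩ := exists_nat_gt (2 * (n * N : ℝ) / δ)
  have hM' : (n * N : ℝ) ≤ δ / 2 * M := by
    rw [div_lt_iff₀ hδ] at hM; linarith
  have hM0 : 0 < M := by
    have : (0 : ℝ) < M := lt_of_le_of_lt (by positivity) hM
    exact_mod_cast this
  refine ⟨M, hM0, fun S hS => ?_⟩
  have h1 : ∀ w : Fin N → Fin (n + 1), δ / 2 * M ≤
      ∑ s ∈ Finset.range M, ind (s + ∑ t, (w t : ℕ) < M ∧ S (s + ∑ t, (w t : ℕ))) := by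
    intro w
    set σ := ∑ t, (w t : ℕ) with hσ
    have hσle : σ ≤ n * N := by
      calc σ ≤ ∑ _t : Fin N, n := Finset.sum_le_sum fun t _ => by have := (w t).2; omega
        _ = n * N := by simp [mul_comm]
    have hσr : (σ : ℝ) ≤ n * N := by exact_mod_cast hσle
    let F : ℕ → ℝ := fun i => ind (i < M ∧ S i)
    have e1 := Finset.sum_range_add F σ M
    have e2 := Finset.sum_range_add F M σ
    have e3 : ∑ i ∈ Finset.range M, F i = ∑ i ∈ Finset.range M, ind (S i) := by
      refine Finset.sum_congr rfl fun i hi => ?_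
      have := Finset.mem_range.1 hi
      simp [F, this]
    have e4 : ∑ i ∈ Finset.range σ, F i ≤ σ := by
      calc _ ≤ ∑ i ∈ Finset.range σ, (1 : ℝ) := Finset.sum_le_sum fun i _ => ind_le_one _
        _ = σ := by simp
    have e5 : 0 ≤ ∑ i ∈ Finset.range σ, F (M + i) :=
      Finset.sum_nonneg fun i _ => ind_nonneg _
    have e6 : ∑ s ∈ Finset.range M, ind (s + σ < M ∧ S (s + σ))
        = ∑ s ∈ Finset.range M, F (σ + s) := by
      refine Finset.sum_congr rfl fun i hi => ?_
      simp only [F, add_comm]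
    rw [e6]
    rw [add_comm M σ] at e2
    linarith
  have h2 := Finset.sum_le_sum fun w (_ : w ∈ (Finset.univ : Finset (Fin N → Fin (n + 1)))) => h1 w
  rw [Finset.sum_comm] at h2
  obtain ⟨s, -, hs⟩ : ∃ s ∈ Finset.range M, δ / 2 * ((n + 1 : ℕ) : ℝ) ^ N ≤
      ∑ w : Fin N → Fin (n + 1), ind (s + ∑ t, (w t : ℕ) < M ∧ S (s + ∑ t, (w t : ℕ))) := by
    refine Finset.exists_le_of_sum_le ⟨0, Finset.mem_range.2 hM0⟩ (le_trans (le_of_eq ?_) h2)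
    simp
    ring
  obtain ⟨l, hl⟩ := hN (Fin N) (by simp) (fun w => s + ∑ t, (w t : ℕ) < M ∧ S (s + ∑ t, (w t : ℕ)))
    (by simpa using hs)
  obtain ⟨c, d, hd, hcd⟩ := sum_line l
  refine ⟨s + c, d, hd, fun i hi => ?_⟩
  have := hl ⟨i, by omega⟩
  simp only [hcd] at this
  simpa [add_assoc] using this

/-- The sign sequence of `A`. -/
noncomputable def sgn (A : Set ℕ) (m : ℕ) : ℝ := 2 * ind (m ∈ A) - 1

lemma sgn_sq (A : Set ℕ) (m : ℕ) : sgn A m * sgn A m = 1 := by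
  unfold sgn
  by_cases h : m ∈ A
  · rw [ind_pos h]; norm_num
  · rw [ind_neg h]; norm_num

lemma sgn_abs (A : Set ℕ) (m : ℕ) : -1 ≤ sgn A m ∧ sgn A m ≤ 1 := by
  have := ind_nonneg (m ∈ A)
  have := ind_le_one (m ∈ A)
  unfold sgn
  constructor <;> linarith

lemma card_eq_sum (P : ℕ → Prop) [DecidablePred P] (n : ℕ) :
    (((Finset.Icc 1 n).filter P).card : ℝ) = ∑ m ∈ Finset.range n, ind (P (m + 1)) := by
  induction n with
  | zero => simp
  | succ n ih =>
    rw [Finset.sum_range_succ, ← ih, ← Finset.insert_Icc_right_eq_Icc_add_one (by omega), Finset.filter_insert]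
    by_cases h : P (n + 1)
    · rw [if_pos h, ind_pos h, Finset.card_insert_of_notMem (by simp)]; push_cast; rfl
    · rw [if_neg h, ind_neg h, add_zero]

lemma corr {A : Set ℕ} (hA : ClassicalNormalSet A) {k k' : ℕ} (hk : 0 < k) (hk' : 0 < k')
    (hne : k ≠ k') :
    Tendsto (fun n : ℕ => (∑ m ∈ Finset.range n, sgn A (m + 1 + k) * sgn A (m + 1 + k')) / (n : ℝ))
      atTop (nhds 0) := by
  have hK : ∀ k₁ ∈ ({k, k'} : Finset ℕ), 0 < k₁ := by
    intro x hx
    simp only [Finset.mem_insert, Finset.mem_singleton] at hx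
    omega
  have h1 := hA {k, k'} ⟨k, by simp⟩ hK (fun _ => true)
  have h2 := hA {k, k'} ⟨k, by simp⟩ hK (fun _ => false)
  rw [Finset.card_pair hne] at h1 h2
  have h3 := ((h1.add h2).const_mul 2).sub_const 1
  norm_num at h3
  refine h3.congr' ?_
  filter_upwards [eventually_gt_atTop 0] with n hn
  have hn' : (n : ℝ) ≠ 0 := by positivity
  rw [card_eq_sum, card_eq_sum]
  simp only [Finset.mem_insert, Finset.mem_singleton, forall_eq_or_imp, forall_eq, iff_true,
    Bool.false_eq_true, iff_false]
  have : ∑ m ∈ Finset.range n, sgn A (m + 1 + k) * sgn A (m + 1 + k') =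
      2 * (∑ m ∈ Finset.range n, ind (k + (m + 1) ∈ A ∧ k' + (m + 1) ∈ A)
        + ∑ m ∈ Finset.range n, ind (k + (m + 1) ∉ A ∧ k' + (m + 1) ∉ A)) - n := by
    have hn1 : (n : ℝ) = ∑ m ∈ Finset.range n, (1 : ℝ) := by simp
    rw [hn1, ← Finset.sum_add_distrib, Finset.mul_sum, ← Finset.sum_sub_distrib]
    refine Finset.sum_congr rfl fun m _ => ?_
    unfold sgn
    rw [add_comm k, add_comm k']
    by_cases p : m + 1 + k ∈ A <;> by_cases p' : m + 1 + k' ∈ A <;> simp [ind, p, p'] <;> norm_num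
  rw [this]
  field_simp

/-- Second moment bound for blocks. -/
lemma second_moment {A : Set ℕ} (hA : ClassicalNormalSet A) {f K : ℕ} (hf : 0 < f) (hK : 0 < K) :
    ∀ᶠ n : ℕ in atTop, ∑ m ∈ Finset.range n,
      (∑ j ∈ Finset.range K, sgn A (m + 1 + f * (j + 1))) ^ 2 ≤ 2 * K * n := by
  have h : Tendsto (fun n : ℕ => ∑ j ∈ Finset.range K, ∑ j' ∈ Finset.range K,
      (∑ m ∈ Finset.range n, sgn A (m + 1 + f * (j + 1)) * sgn A (m + 1 + f * (j' + 1))) / (n : ℝ))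
      atTop (nhds (∑ j ∈ Finset.range K, ∑ j' ∈ Finset.range K, if j = j' then (1 : ℝ) else 0)) := by
    refine tendsto_finsetSum _ fun j _ => tendsto_finsetSum _ fun j' _ => ?_
    by_cases hj : j = j'
    · subst hj
      simp only [sgn_sq, if_true]
      refine (tendsto_const_nhds (x := (1 : ℝ))).congr' ?_
      filter_upwards [eventually_gt_atTop 0] with n hn
      have hn' : (n : ℝ) ≠ 0 := by positivity
      simp [hn']
    · rw [if_neg hj]
      refine corr hA (by positivity) (by positivity) fun h => hj ?_
      have := Nat.eq_of_mul_eq_mul_left hf h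
      omega
  have hlim : (∑ j ∈ Finset.range K, ∑ j' ∈ Finset.range K, if j = j' then (1 : ℝ) else 0) = K := by
    rw [Finset.sum_congr rfl (g := fun _ => (1 : ℝ))]
    · simp
    · intro j hj
      rw [Finset.sum_ite_eq, if_pos hj]
  rw [hlim] at h
  have hK' : (K : ℝ) < 2 * K := by
    have : (0 : ℝ) < K := by exact_mod_cast hK
    linarith
  filter_upwards [h.eventually_lt_const hK', eventually_gt_atTop 0] with n hn hn0
  have hn' : (0 : ℝ) < n := by exact_mod_cast hn0
  simp only [← Finset.sum_div] at hn
  rw [div_lt_iff₀ hn'] at hn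
  refine le_trans (le_of_eq ?_) hn.le
  have e1 : ∀ j ∈ Finset.range K, ∑ j' ∈ Finset.range K, ∑ m ∈ Finset.range n,
      sgn A (m + 1 + f * (j + 1)) * sgn A (m + 1 + f * (j' + 1)) =
      ∑ m ∈ Finset.range n, ∑ j' ∈ Finset.range K,
      sgn A (m + 1 + f * (j + 1)) * sgn A (m + 1 + f * (j' + 1)) := fun j _ => Finset.sum_comm
  rw [Finset.sum_congr rfl e1, Finset.sum_comm]
  refine Finset.sum_congr rfl fun m _ => ?_
  rw [sq, Finset.sum_mul_sum]

/-- Every dilate of a normal set is hit with frequency at least a quarter. -/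
lemma dilate {A : Set ℕ} (hA : ClassicalNormalSet A) {f : ℕ} (hf : 0 < f) :
    ∀ᶠ n : ℕ in atTop, (n : ℝ) / 4 ≤ ∑ m ∈ Finset.range n, ind ((m + 1) * f ∈ A) := by
  set K := 32 * f with hKdef
  have hK : 0 < K := by positivity
  have hmul : Tendsto (fun n : ℕ => f * n) atTop atTop := tendsto_id.const_mul_atTop' hf
  filter_upwards [hmul.eventually (second_moment hA hf hK), eventually_ge_atTop (8 * K)]
    with n hn hn8
  let g : ℕ → ℝ := fun m => ∑ j ∈ Finset.range K, sgn A (m + f * (j + 1))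
  have hn8' : (8 * K : ℝ) ≤ n := by exact_mod_cast hn8
  have hK0 : (0 : ℝ) < K := by exact_mod_cast hK
  have hKf : (K : ℝ) = 32 * f := by rw [hKdef]; push_cast; rfl
  -- restrict to multiples of f
  have s1 : ∑ m ∈ Finset.range n, g (f * (m + 1)) ^ 2 ≤ 2 * K * (f * n) := by
    push_cast at hn
    refine le_trans ?_ hn
    have hinj : Set.InjOn (fun m => f * (m + 1) - 1) (Finset.range n : Set ℕ) := by
      intro a _ b _ hab
      have ha : 0 < f * (a + 1) := by positivity
      have hb : 0 < f * (b + 1) := by positivity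
      have h' : f * (a + 1) = f * (b + 1) := by simp only at hab; omega
      have := Nat.eq_of_mul_eq_mul_left hf h'
      omega
    have e : ∑ m ∈ Finset.range n, g (f * (m + 1)) ^ 2 =
        ∑ m ∈ (Finset.range n).image (fun m => f * (m + 1) - 1), g (m + 1) ^ 2 := by
      rw [Finset.sum_image hinj]
      refine Finset.sum_congr rfl fun m _ => ?_
      have ha : 0 < f * (m + 1) := by positivity
      rw [Nat.sub_add_cancel ha]
    rw [e]
    refine Finset.sum_le_sum_of_subset_of_nonneg ?_ fun _ _ _ => sq_nonneg _
    intro x hx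
    obtain ⟨m, hm, rfl⟩ := Finset.mem_image.1 hx
    rw [Finset.mem_range] at hm ⊢
    have ha : 0 < f * (m + 1) := by positivity
    have hb : f * (m + 1) ≤ f * n := Nat.mul_le_mul_left f hm
    omega
  -- Cauchy-Schwarz
  have s2 : (∑ m ∈ Finset.range n, g (f * (m + 1))) ^ 2 ≤
      n * ∑ m ∈ Finset.range n, g (f * (m + 1)) ^ 2 := by
    simpa using sq_sum_le_card_mul_sum_sq (s := Finset.range n) (f := fun m => g (f * (m + 1)))
  have hnn : (0 : ℝ) ≤ n := by positivity
  have s3 : (∑ m ∈ Finset.range n, g (f * (m + 1))) ^ 2 ≤ (K / 4 * n) ^ 2 := by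
    refine s2.trans ?_
    have := mul_le_mul_of_nonneg_left s1 hnn
    refine this.trans (le_of_eq ?_)
    rw [hKf]; ring
  have s4 : -(K / 4 * n : ℝ) ≤ ∑ m ∈ Finset.range n, g (f * (m + 1)) :=
    (abs_le_of_sq_le_sq' s3 (by positivity)).1
  -- shifting
  let y : ℕ → ℝ := fun m => sgn A (f * (m + 1))
  have s5 : ∀ j ∈ Finset.range K, ∑ m ∈ Finset.range n, y (m + (j + 1)) ≤
      ∑ m ∈ Finset.range n, y m + 2 * K := by
    intro j hj
    have hj' : ((j + 1 : ℕ) : ℝ) ≤ K := by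
      have := Finset.mem_range.1 hj
      exact_mod_cast this
    have e1 := Finset.sum_range_add y n (j + 1)
    have e2 := Finset.sum_range_add y (j + 1) n
    have b1 : ∑ i ∈ Finset.range (j + 1), y (n + i) ≤ ((j + 1 : ℕ) : ℝ) := by
      calc _ ≤ ∑ i ∈ Finset.range (j + 1), (1 : ℝ) :=
            Finset.sum_le_sum fun i _ => (sgn_abs A _).2
        _ = _ := by simp
    have b2 : -((j + 1 : ℕ) : ℝ) ≤ ∑ i ∈ Finset.range (j + 1), y i := by
      calc -((j + 1 : ℕ) : ℝ) = ∑ i ∈ Finset.range (j + 1), (-1 : ℝ) := by simp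
        _ ≤ _ := Finset.sum_le_sum fun i _ => (sgn_abs A _).1
    rw [add_comm (j + 1) n] at e2
    have e3 : ∑ m ∈ Finset.range n, y (m + (j + 1)) = ∑ m ∈ Finset.range n, y (j + 1 + m) :=
      Finset.sum_congr rfl fun m _ => by rw [add_comm]
    linarith
  have s6 : ∑ m ∈ Finset.range n, g (f * (m + 1)) ≤ K * (∑ m ∈ Finset.range n, y m + 2 * K) := by
    calc ∑ m ∈ Finset.range n, g (f * (m + 1))
        = ∑ j ∈ Finset.range K, ∑ m ∈ Finset.range n, y (m + (j + 1)) := by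
          rw [Finset.sum_comm]
          refine Finset.sum_congr rfl fun m _ => Finset.sum_congr rfl fun j _ => ?_
          simp only [y]
          congr 1
          ring
      _ ≤ ∑ _j ∈ Finset.range K, (∑ m ∈ Finset.range n, y m + 2 * K) := Finset.sum_le_sum s5
      _ = _ := by simp [mul_add]
  have s7 : -(n / 4 : ℝ) ≤ ∑ m ∈ Finset.range n, y m + 2 * K := by
    have : K * (-(n / 4 : ℝ)) ≤ K * (∑ m ∈ Finset.range n, y m + 2 * K) := by linarith
    exact le_of_mul_le_mul_left this hK0
  have s8 : ∑ m ∈ Finset.range n, y m = 2 * ∑ m ∈ Finset.range n, ind ((m + 1) * f ∈ A) - n := by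
    have hn1 : (n : ℝ) = ∑ m ∈ Finset.range n, (1 : ℝ) := by simp
    rw [hn1, Finset.mul_sum, ← Finset.sum_sub_distrib]
    refine Finset.sum_congr rfl fun m _ => ?_
    simp only [y, sgn, mul_comm f]
  linarith

/-- The multiplicative word map. -/
def wordProd {n N : ℕ} (e : Fin N → ℕ) (w : Fin N → Fin (n + 1)) : ℕ :=
  ∏ t, (e t + 1) ^ (w t : ℕ)

lemma wordProd_line {n N : ℕ} (l : Line (Fin (n + 1)) (Fin N)) :
    ∃ t₀ : Fin N, ∀ (a : ℕ) (b : Fin N → ℕ), ∃ c q : ℕ, 0 < c ∧ 0 < q ∧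
      ∀ (i : ℕ) (j : Fin (n + 1)),
        wordProd (a • (Pi.single t₀ i : Fin N → ℕ) + b) (l j)
          = c * (q * (a * i + b t₀ + 1)) ^ (j : ℕ) := by
  classical
  obtain ⟨t₀, ht₀⟩ := l.proper
  refine ⟨t₀, fun a b => ⟨∏ t, (l.idxFun t).elim 1 (fun v => (b t + 1) ^ (v : ℕ)),
    ∏ t, if t = t₀ then 1 else (l.idxFun t).elim (b t + 1) (fun _ => 1), ?_, ?_, fun i j => ?_⟩⟩
  · refine Finset.prod_pos fun t _ => ?_
    rcases l.idxFun t with _ | v <;> simp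
  · refine Finset.prod_pos fun t _ => ?_
    split_ifs
    · simp
    · rcases l.idxFun t with _ | v <;> simp
  · have hx : a * i + b t₀ + 1 = ∏ t : Fin N, if t = t₀ then a * i + b t₀ + 1 else 1 := by simp
    rw [hx, ← Finset.prod_mul_distrib, ← Finset.prod_pow, ← Finset.prod_mul_distrib, wordProd]
    refine Finset.prod_congr rfl fun t _ => ?_
    by_cases h : t = t₀
    · subst h
      rw [Line.apply_none _ _ _ ht₀]
      simp [ht₀]
    · rcases ht : l.idxFun t with _ | v
      · rw [Line.apply_none _ _ _ ht]; simp [h]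
      · rw [Line.apply_some ht]; simp [h]

lemma wordProd_pos {n N : ℕ} (e : Fin N → ℕ) (w : Fin N → Fin (n + 1)) : 0 < wordProd e w :=
  Finset.prod_pos fun t _ => by positivity

lemma finite_line {n N : ℕ} : Finite (Line (Fin (n + 1)) (Fin N)) := by
  refine Finite.of_injective (fun l : Line (Fin (n + 1)) (Fin N) => l.idxFun) ?_
  rintro ⟨f, hf⟩ ⟨g, hg⟩ h
  simp only at h
  subst h
  rfl

lemma frequent_line {A : Set ℕ} (hA : ClassicalNormalSet A) (n : ℕ) :
    ∃ (N : ℕ) (δ : ℝ), 0 < δ ∧ ∀ e : Fin N → ℕ, ∀ᶠ r : ℕ in atTop,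
      ∃ l : Line (Fin (n + 1)) (Fin N),
        δ * r ≤ ∑ m ∈ Finset.range r, ind (∀ j, (m + 1) * wordProd e (l j) ∈ A) := by
  classical
  obtain ⟨N, hN⟩ := dhj (n + 1) (1 / 8) (by norm_num)
  refine ⟨N, (1 / 8) / Fintype.card (Fin N → Option (Fin (n + 1))), ?_, fun e => ?_⟩
  · have : 0 < Fintype.card (Fin N → Option (Fin (n + 1))) := Fintype.card_pos
    positivity
  have hall : ∀ᶠ r : ℕ in atTop, ∀ w : Fin N → Fin (n + 1),
      (r : ℝ) / 4 ≤ ∑ m ∈ Finset.range r, ind ((m + 1) * wordProd e w ∈ A) :=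
    eventually_all.2 fun w => dilate hA (wordProd_pos e w)
  filter_upwards [hall, eventually_gt_atTop 0] with r hr hr0
  have : Nonempty (Fin r) := ⟨⟨0, hr0⟩⟩
  have hN' := hN (Fin N) (by simp)
  simp only [Fintype.card_fin (N)] at hN'
  obtain ⟨l, hl⟩ := pigeon_line (Ω := Fin r) (by norm_num) hN'
    (fun w m => ((m : ℕ) + 1) * wordProd e w ∈ A) (by
      rw [Finset.sum_comm]
      have h2 := Finset.sum_le_sum
        fun w (_ : w ∈ (Finset.univ : Finset (Fin N → Fin (n + 1)))) => hr w
      refine le_trans (le_of_eq ?_) (h2.trans (le_of_eq ?_))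
      · simp; ring
      · refine Finset.sum_congr rfl fun w _ => ?_
        rw [Finset.sum_range])
  refine ⟨l, ?_⟩
  rw [Finset.sum_range]
  simpa using hl

end GeoArith

open GeoArith in
theorem classicalNormal_contains_geoarithmetic
    (A : Set ℕ) (hA : ClassicalNormalSet A) (n : ℕ) :
    ∃ a b d : ℕ, 0 < a ∧ 0 < b ∧ 0 < d ∧
      ∀ i j : ℕ, i ≤ n → j ≤ n → b * (a + i * d) ^ j ∈ A := by
  classical
  obtain ⟨N, δ, hδ, hfreq⟩ := frequent_line hA n
  have := finite_line (n := n) (N := N)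
  let U : Ultrafilter ℕ := Ultrafilter.of atTop
  have hU : (U : Filter ℕ) ≤ atTop := Ultrafilter.of_le atTop
  have hcol : ∀ e : Fin N → ℕ, ∃ l : Combinatorics.Line (Fin (n + 1)) (Fin N),
      ∀ᶠ r : ℕ in (U : Filter ℕ),
        δ * r ≤ ∑ m ∈ Finset.range r, ind (∀ j, (m + 1) * wordProd e (l j) ∈ A) :=
    fun e => Ultrafilter.eventually_exists_iff.1 (hU (hfreq e))
  choose C hC using hcol
  obtain ⟨M, hM0, hM⟩ := szemeredi n hδ
  obtain ⟨a, ha, b, l, hmono⟩ := Combinatorics.exists_mono_homothetic_copy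
    (((Finset.univ : Finset (Fin N)) ×ˢ Finset.range M).image
      fun p => (Pi.single p.1 p.2 : Fin N → ℕ)) C
  obtain ⟨t₀, hline⟩ := wordProd_line l
  obtain ⟨c, q, hc, hq, hprod⟩ := hline a b
  have hev : ∀ᶠ r : ℕ in (U : Filter ℕ), ∀ i ∈ Finset.range M,
      δ * r ≤ ∑ m ∈ Finset.range r,
        ind (∀ j : Fin (n + 1), (m + 1) * (c * (q * (a * i + b t₀ + 1)) ^ (j : ℕ)) ∈ A) := by
    rw [Filter.eventually_all_finset]
    intro i hi
    have h1 := hC (a • (Pi.single t₀ i : Fin N → ℕ) + b)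
    rw [hmono _ (Finset.mem_image.2 ⟨(t₀, i), by simpa using hi, rfl⟩)] at h1
    simpa only [hprod] using h1
  obtain ⟨r, hr, hr0⟩ := (hev.and (hU (eventually_gt_atTop 0))).exists
  have h2 := Finset.sum_le_sum hr
  rw [Finset.sum_comm] at h2
  obtain ⟨m, -, hm⟩ : ∃ m ∈ Finset.range r, δ * M ≤ ∑ i ∈ Finset.range M,
      ind (∀ j : Fin (n + 1), (m + 1) * (c * (q * (a * i + b t₀ + 1)) ^ (j : ℕ)) ∈ A) := by
    refine Finset.exists_le_of_sum_le ⟨0, Finset.mem_range.2 hr0⟩ (le_trans (le_of_eq ?_) h2)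
    simp
    ring
  obtain ⟨i₀, d, hd, hAP⟩ := hM _ hm
  refine ⟨q * (a * i₀ + b t₀ + 1), (m + 1) * c, q * a * d, by positivity, by positivity,
    by positivity, fun i j hi hj => ?_⟩
  have := (hAP i hi).2 ⟨j, by omega⟩
  convert this using 1
  simp only
  rw [mul_assoc (m + 1)]
  congr 3
  ring
end

section
/- There exists a multiplicatively net-normal set A ⊆ ℕ, i.e., a set A whose indicator function is (F_n)-normal in (ℕ,×) for every nice Følner sequence (F_n) in (ℕ,×). -/
open Filter

/- `(F n)` is a Følner sequence in `(ℕ,×)` (positive integers under multiplication). -/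
def MulFolner (F : ℕ → Finset ℕ) : Prop :=
  (∀ n, (F n).Nonempty) ∧ (∀ n, 0 ∉ F n) ∧
  ∀ k : ℕ, 0 < k → Tendsto
    (fun n => (((F n).filter (fun m => k * m ∈ F n)).card : ℝ) / (F n).card)
    atTop (nhds 1)

/- A nice Følner sequence in `(ℕ,×)`: `F n` is the set of positive divisors of `L n`,
where `L n` is a proper divisor of `L (n+1)` and every positive integer divides `L n`
for all sufficiently large `n`. -/
def NiceFolner (F : ℕ → Finset ℕ) : Prop :=
  ∃ L : ℕ → ℕ, (∀ n, 0 < L n) ∧ (∀ n, L n ∣ L (n + 1)) ∧ (∀ n, L n ≠ L (n + 1)) ∧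
    (∀ m : ℕ, 0 < m → ∀ᶠ n in atTop, m ∣ L n) ∧ (∀ n, F n = (L n).divisors)

/- `A ⊆ ℕ` is `(F n)`-normal in `(ℕ,×)`. -/
open scoped Classical in
def MulNormalSet (F : ℕ → Finset ℕ) (A : Set ℕ) : Prop :=
  ∀ K : Finset ℕ, K.Nonempty → (∀ k ∈ K, 0 < k) → ∀ B : ℕ → Bool,
    Tendsto
      (fun n =>
        (((F n).filter (fun m => ∀ k ∈ K, (k * m ∈ A ↔ B k = true))).card : ℝ) / (F n).card)
      atTop (nhds ((1 / 2 : ℝ) ^ K.card))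

lemma bit_count (M : ℕ) (B : ℕ → Bool) (I : Finset ℕ) (hI : ∀ i ∈ I, i < M) :
    2 ^ I.card * ((Finset.range (2 ^ M)).filter (fun q => ∀ i ∈ I, q.testBit i = B i)).card
      = 2 ^ M := by
  classical
  induction I using Finset.induction_on with
  | empty => simp
  | insert j I hj ih =>
    have ih' := ih (fun i hi => hI i (Finset.mem_insert_of_mem hi))
    have hjM : j < M := hI j (Finset.mem_insert_self _ _)
    rw [Finset.card_insert_of_notMem hj]
    refine Eq.trans ?_ ih'
    rw [pow_succ, mul_assoc]
    congr 1
    set S := (Finset.range (2 ^ M)).filter (fun q => ∀ i ∈ I, q.testBit i = B i) with hS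
    have e1 : (Finset.range (2 ^ M)).filter (fun q => ∀ i ∈ insert j I, q.testBit i = B i)
        = S.filter (fun q => q.testBit j = B j) := by
      ext q
      simp only [hS, Finset.mem_filter, Finset.mem_insert, forall_eq_or_imp]
      tauto
    rw [e1, ← Finset.card_filter_add_card_filter_not (s := S) (fun q => q.testBit j = B j), two_mul]
    congr 1
    have key : ∀ q ∈ S, q ^^^ 2 ^ j ∈ S := by
      intro q hq
      simp only [hS, Finset.mem_filter, Finset.mem_range] at hq ⊢
      refine ⟨Nat.xor_lt_two_pow hq.1 (Nat.pow_lt_pow_right (by norm_num) hjM), fun i hi => ?_⟩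
      rw [Nat.testBit_xor, Nat.testBit_two_pow_of_ne, hq.2 i hi]
      · simp
      · rintro rfl; exact hj hi
    apply Finset.card_bij (fun q _ => q ^^^ 2 ^ j)
    · intro q hq
      rw [Finset.mem_filter] at hq ⊢
      refine ⟨key q hq.1, ?_⟩
      rw [Nat.testBit_xor, Nat.testBit_two_pow_self, hq.2]
      cases B j <;> simp
    · intro a _ b _ h
      exact Nat.xor_left_injective h
    · intro q hq
      rw [Finset.mem_filter] at hq
      refine ⟨q ^^^ 2 ^ j, ?_, by simp⟩
      rw [Finset.mem_filter]
      refine ⟨key q hq.1, ?_⟩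
      have := hq.2
      rw [Nat.testBit_xor, Nat.testBit_two_pow_self]
      revert this
      cases B j <;> cases q.testBit j <;> simp

lemma bit_count' {K : Finset ℕ} (M c : ℕ) (B : ℕ → Bool) (g : ℕ → ℕ) (hg : ∀ k ∈ K, g k < M)
    (hinj : ∀ k ∈ K, ∀ k' ∈ K, g k = g k' → k = k') :
    (((Finset.range (2 ^ M)).filter
      (fun q => ∀ k ∈ K, ((2 ^ M * c + q).testBit (g k) = true ↔ B k = true))).card : ℝ)
      = (1 / 2 : ℝ) ^ K.card * 2 ^ M := by
  classical
  have hB : ∃ B' : ℕ → Bool, ∀ k ∈ K, B' (g k) = B k := by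
    refine ⟨fun i => decide (∃ k ∈ K, g k = i ∧ B k = true), fun k hk => ?_⟩
    rw [Bool.eq_iff_iff, decide_eq_true_iff]
    constructor
    · rintro ⟨k', h1, h2, h3⟩
      rw [← hinj k' h1 k hk h2]; exact h3
    · intro h; exact ⟨k, hk, rfl, h⟩
  obtain ⟨B', hB'⟩ := hB
  have h := bit_count M B' (K.image g) (by simpa using hg)
  rw [Finset.card_image_of_injOn (fun a ha b hb => hinj a ha b hb)] at h
  have e : (Finset.range (2 ^ M)).filter
      (fun q => ∀ k ∈ K, ((2 ^ M * c + q).testBit (g k) = true ↔ B k = true))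
      = (Finset.range (2 ^ M)).filter (fun q => ∀ i ∈ K.image g, q.testBit i = B' i) := by
    apply Finset.filter_congr
    intro q hq
    rw [Finset.mem_range] at hq
    simp only [Finset.forall_mem_image]
    refine forall₂_congr fun k hk => ?_
    rw [Nat.testBit_two_pow_mul_add _ hq, if_pos (hg k hk), hB' k hk]
    exact Bool.eq_iff_iff.symm
  rw [e]
  have h' : (2:ℝ) ^ K.card * (((Finset.range (2 ^ M)).filter
     (fun q => ∀ i ∈ K.image g, q.testBit i = B' i)).card : ℝ) = 2 ^ M := by exact_mod_cast h
  rw [← h', ← mul_assoc, ← mul_pow]; norm_num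

lemma sum_range_mul_aux (f : ℕ → ℝ) (m n : ℕ) :
    ∑ i ∈ Finset.range (m * n), f i
      = ∑ q ∈ Finset.range n, ∑ r ∈ Finset.range m, f (m * q + r) := by
  induction n with
  | zero => simp
  | succ n ih => rw [Nat.mul_succ, Finset.sum_range_add, ih, Finset.sum_range_succ]

lemma avg_lemma (f : ℕ → ℝ) (hf : ∀ a, |f a| ≤ 1) (ε : ℝ) (hε : 0 < ε) (t0 : ℕ) (p : ℕ → ℕ)
    (h1 : ∀ t ≥ t0, p t ≤ t) (h2 : ∀ t ≥ t0, (2:ℝ) ^ p t ≤ ε * 2 ^ t)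
    (h3 : ∀ t ≥ t0, ∀ c, 2 ^ t ≤ 2 ^ p t * c → 2 ^ p t * (c + 1) ≤ 2 ^ (t + 1) →
      |∑ i ∈ Finset.range (2 ^ p t), f (2 ^ p t * c + i)| ≤ ε * 2 ^ p t)
    (E : ℕ) (hE : 2 ^ t0 ≤ E) :
    |∑ a ∈ Finset.range E, f a| ≤ 2 ^ t0 + 2 * ε * E := by
  have triv : ∀ n m, |∑ i ∈ Finset.range n, f (m + i)| ≤ n := by
    intro n m
    refine (Finset.abs_sum_le_sum_abs _ _).trans ((Finset.sum_le_sum fun i _ => hf _).trans ?_)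
    simp
  have s1 : ∀ t ≥ t0, ∀ c, 2 ^ (t - p t) + c ≤ 2 ^ (t + 1 - p t) →
      |∑ a ∈ Finset.range (2 ^ p t * (2 ^ (t - p t) + c)), f a|
       ≤ |∑ a ∈ Finset.range (2 ^ t), f a| + ε * (2 ^ p t * c) := by
    intro t ht c
    have ep : 2 ^ p t * 2 ^ (t - p t) = 2 ^ t := by
      rw [← pow_add]; congr 1; have := h1 t ht; omega
    have ep' : 2 ^ p t * 2 ^ (t + 1 - p t) = 2 ^ (t + 1) := by
      rw [← pow_add]; congr 1; have := h1 t ht; omega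
    induction c with
    | zero => intro _; simp [ep]
    | succ c ih =>
      intro hc
      have ih' := ih (by omega)
      have := h3 t ht (2 ^ (t - p t) + c) (by rw [mul_add, ep]; omega)
        (by rw [← ep']; exact Nat.mul_le_mul_left _ (by omega))
      rw [← add_assoc, Nat.mul_succ, Finset.sum_range_add]
      refine (abs_add_le _ _).trans ?_
      push_cast
      linarith
  have s2 : ∀ j, |∑ a ∈ Finset.range (2 ^ (t0 + j)), f a| ≤ 2 ^ t0 + ε * 2 ^ (t0 + j) := by
    intro j
    induction j with
    | zero =>
      have := triv (2 ^ t0) 0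
      simp only [zero_add] at this
      push_cast at this
      have : 0 < ε * 2 ^ t0 := by positivity
      simp; linarith
    | succ j ih =>
      have ht : t0 + j ≥ t0 := by omega
      have hp := h1 _ ht
      set t := t0 + j
      have e0 : 2 ^ (t + 1 - p t) = 2 ^ (t - p t) + 2 ^ (t - p t) := by
        rw [show t + 1 - p t = (t - p t) + 1 by omega, pow_succ]; ring
      have := s1 t ht (2 ^ (t - p t)) (by rw [e0])
      rw [← e0, ← pow_add, show p t + (t + 1 - p t) = t + 1 by omega] at this
      have e2 : (2:ℝ) ^ p t * ((2 ^ (t - p t) : ℕ) : ℝ) = 2 ^ t := by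
        push_cast; rw [← pow_add]; congr 1; omega
      rw [e2] at this
      rw [show t0 + (j + 1) = t + 1 by omega, pow_succ (2:ℝ)]
      linarith
  have hE0 : E ≠ 0 := by have : 0 < 2 ^ t0 := by positivity
                         omega
  set t := Nat.log 2 E with htdef
  have ht : t0 ≤ t := Nat.le_log_of_pow_le (by norm_num) hE
  have l1 : 2 ^ t ≤ E := Nat.pow_log_le_self 2 hE0
  have l2 : E < 2 ^ (t + 1) := Nat.lt_pow_succ_log_self (by norm_num) E
  have hp := h1 t ht
  have ep : 2 ^ p t * 2 ^ (t - p t) = 2 ^ t := by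
    rw [← pow_add]; congr 1; omega
  have ep' : 2 ^ p t * 2 ^ (t + 1 - p t) = 2 ^ (t + 1) := by
    rw [← pow_add]; congr 1; omega
  have hpos : 0 < 2 ^ p t := by positivity
  have hdiv : 2 ^ (t - p t) ≤ E / 2 ^ p t := by
    rw [Nat.le_div_iff_mul_le hpos, mul_comm, ep]; exact l1
  obtain ⟨c, hc⟩ := Nat.exists_eq_add_of_le hdiv
  have hmod := Nat.div_add_mod E (2 ^ p t)
  have hlt := Nat.mod_lt E hpos
  have hc2 : 2 ^ (t - p t) + c ≤ 2 ^ (t + 1 - p t) := by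
    rw [← hc]
    apply le_of_lt
    rw [Nat.div_lt_iff_lt_mul hpos, mul_comm, ep']; exact l2
  have a1 := s1 t ht c hc2
  have a2 := s2 (t - t0)
  rw [show t0 + (t - t0) = t by omega] at a2
  have a3 := triv (E % 2 ^ p t) (2 ^ p t * (2 ^ (t - p t) + c))
  rw [hc] at hmod
  have a4 : ∑ a ∈ Finset.range E, f a = ∑ a ∈ Finset.range (2 ^ p t * (2 ^ (t - p t) + c)), f a
     + ∑ i ∈ Finset.range (E % 2 ^ p t), f (2 ^ p t * (2 ^ (t - p t) + c) + i) := by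
    rw [← Finset.sum_range_add, hmod]
  rw [a4]
  refine (abs_add_le _ _).trans ?_
  have a5 : ((E % 2 ^ p t : ℕ) : ℝ) ≤ 2 ^ p t := by exact_mod_cast hlt.le
  have a6 := h2 t ht
  have a7 : (2:ℝ) ^ t + 2 ^ p t * c ≤ E := by
    have : 2 ^ t + 2 ^ p t * c ≤ E := by rw [← ep, ← mul_add]; omega
    exact_mod_cast this
  have a8 : (2:ℝ) ^ t ≤ E := by exact_mod_cast l1
  have := mul_le_mul_of_nonneg_left a7 hε.le
  have := mul_le_mul_of_nonneg_left a8 hε.le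
  linarith

lemma exists_code : ∃ (M : ℕ → ℕ) (φ : ℕ → ℕ → ℕ → ℕ),
    (∀ s r n, r < 2 ^ s → φ s r n < M s) ∧
    ∀ s r r' k k' n, r < 2 ^ s → r' < 2 ^ s → 0 < n → 0 < k → 0 < k' → k < s → k' < s →
      φ s r (k * n) = φ s r' (k' * n) → r = r' ∧ k = k' := by
  classical
  let G : ℕ → Type := fun s => Fin (2 ^ s) × (Fin s → ZMod (s + 1))
  let e : ∀ s, G s ≃ Fin (Fintype.card (G s)) := fun s => Fintype.equivFin _
  refine ⟨fun s => Fintype.card (G s), fun s r n =>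
    e s (⟨r % 2 ^ s, Nat.mod_lt _ (by positivity)⟩, fun p => (n.factorization p : ZMod (s + 1))),
    fun s r n _ => Fin.isLt _, ?_⟩
  intro s r r' k k' n hr hr' hn hk hk' hks hks' h
  have h := (e s).injective (Fin.ext h)
  have h := Prod.mk.inj h
  have ha := h.1
  simp only [Fin.mk.injEq, Nat.mod_eq_of_lt hr, Nat.mod_eq_of_lt hr'] at ha
  refine ⟨ha, ?_⟩
  apply Nat.eq_of_factorization_eq hk.ne' hk'.ne'
  intro p
  by_cases hp : p < s
  · have h2 := congrFun h.2 ⟨p, hp⟩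
    simp only [Nat.factorization_mul hk.ne' hn.ne', Nat.factorization_mul hk'.ne' hn.ne',
      Finsupp.add_apply, Nat.cast_add, add_left_inj] at h2
    rw [ZMod.natCast_eq_natCast_iff] at h2
    have b1 := Nat.factorization_lt p hk.ne'
    have b2 := Nat.factorization_lt p hk'.ne'
    exact Nat.ModEq.eq_of_lt_of_lt h2 (by omega) (by omega)
  · rw [Nat.factorization_eq_zero_of_lt (by omega), Nat.factorization_eq_zero_of_lt (by omega)]

lemma exists_slow (g : ℕ → ℕ) : ∃ σ : ℕ → ℕ, Tendsto σ atTop atTop ∧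
    ∀ᶠ t in atTop, g (σ t) ≤ t := by
  classical
  refine ⟨fun t => Nat.findGreatest (fun s => g s ≤ t) t, ?_, ?_⟩
  · rw [tendsto_atTop]
    intro b
    filter_upwards [eventually_ge_atTop b, eventually_ge_atTop (g b)] with t h1 h2
    exact Nat.le_findGreatest h1 h2
  · filter_upwards [eventually_ge_atTop (g 0)] with t h
    exact Nat.findGreatest_spec (P := fun s => g s ≤ t) (Nat.zero_le t) h

/-- The set: read a bit of the exponent of `2`, at a position coded by the rest. -/
def bitSet (φ : ℕ → ℕ → ℕ → ℕ) (σ : ℕ → ℕ) : Set ℕ :=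
  {m | Nat.testBit (m.factorization 2 / 2 ^ σ (Nat.log 2 (m.factorization 2)))
    (φ (σ (Nat.log 2 (m.factorization 2)))
      (m.factorization 2 % 2 ^ σ (Nat.log 2 (m.factorization 2)))
      (m / 2 ^ m.factorization 2)) = true}

lemma mem_bitSet (φ : ℕ → ℕ → ℕ → ℕ) (σ : ℕ → ℕ) (k a d t q r : ℕ) (hk : 0 < k)
    (hd : ¬ 2 ∣ d) (hq1 : 2 ^ t ≤ 2 ^ σ t * q) (hq2 : 2 ^ σ t * (q + 1) ≤ 2 ^ (t + 1))
    (ha : a = 2 ^ σ t * q + r) (hr : r + k.factorization 2 < 2 ^ σ t) :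
    k * (2 ^ a * d) ∈ bitSet φ σ ↔
      q.testBit (φ (σ t) (r + k.factorization 2) (k / 2 ^ k.factorization 2 * d)) = true := by
  have hd0 : d ≠ 0 := by rintro rfl; simp at hd
  have e1 : (k * (2 ^ a * d)).factorization 2 = 2 ^ σ t * q + (r + k.factorization 2) := by
    rw [Nat.factorization_mul hk.ne' (by positivity), Nat.factorization_mul (by positivity) hd0,
      Nat.Prime.factorization_pow Nat.prime_two]
    simp [Nat.factorization_eq_zero_of_not_dvd hd]
    omega
  have e2 : k * (2 ^ a * d) / 2 ^ (2 ^ σ t * q + (r + k.factorization 2))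
      = k / 2 ^ k.factorization 2 * d := by
    obtain ⟨u, hu⟩ := Nat.ordProj_dvd k 2
    set b := k.factorization 2 with hb
    have : k / 2 ^ b = u := by
      rw [hu]; exact Nat.mul_div_cancel_left _ (by positivity)
    rw [this, show 2 ^ σ t * q + (r + b) = b + a by omega, hu]
    rw [show 2 ^ b * u * (2 ^ a * d) = 2 ^ (b + a) * (u * d) by ring]
    exact Nat.mul_div_cancel_left _ (by positivity)
  have e3 : Nat.log 2 (2 ^ σ t * q + (r + k.factorization 2)) = t := by
    apply Nat.log_eq_of_pow_le_of_lt_pow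
    · omega
    · rw [mul_add] at hq2; omega
  have e4 : (2 ^ σ t * q + (r + k.factorization 2)) / 2 ^ σ t = q := by
    rw [Nat.mul_add_div (by positivity), Nat.div_eq_of_lt hr, add_zero]
  have e5 : (2 ^ σ t * q + (r + k.factorization 2)) % 2 ^ σ t = r + k.factorization 2 := by
    rw [Nat.mul_add_mod, Nat.mod_eq_of_lt hr]
  simp only [bitSet, Set.mem_ofPred_eq, e1, e2, e3, e4, e5]

open scoped Classical in
lemma block_lemma (M : ℕ → ℕ) (φ : ℕ → ℕ → ℕ → ℕ) (σ : ℕ → ℕ)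
    (hM : ∀ s r n, r < 2 ^ s → φ s r n < M s)
    (hφ : ∀ s r r' k k' n, r < 2 ^ s → r' < 2 ^ s → 0 < n → 0 < k → 0 < k' → k < s → k' < s →
      φ s r (k * n) = φ s r' (k' * n) → r = r' ∧ k = k')
    (K : Finset ℕ) (hK : ∀ k ∈ K, 0 < k) (B : ℕ → Bool) (d : ℕ) (hd : ¬ 2 ∣ d)
    (t R : ℕ) (hKs : ∀ k ∈ K, k < σ t) (hR : ∀ k ∈ K, k ≤ R) (c : ℕ)
    (hc1 : 2 ^ t ≤ 2 ^ (σ t + M (σ t)) * c)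
    (hc2 : 2 ^ (σ t + M (σ t)) * (c + 1) ≤ 2 ^ (t + 1)) :
    |∑ i ∈ Finset.range (2 ^ (σ t + M (σ t))),
      ((if ∀ k ∈ K, (k * (2 ^ (2 ^ (σ t + M (σ t)) * c + i) * d) ∈ bitSet φ σ ↔ B k = true)
        then (1 : ℝ) else 0) - (1 / 2 : ℝ) ^ K.card)| ≤ R * 2 ^ (M (σ t)) := by
  set s := σ t with hs
  set N := M s with hN
  have hd0 : 0 < d := by rcases Nat.eq_zero_or_pos d with rfl | h
                         · simp at hd
                         · exact h
  rw [pow_add] at hc1 hc2 ⊢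
  rw [sum_range_mul_aux, Finset.sum_comm]
  refine (Finset.abs_sum_le_sum_abs _ _).trans ?_
  have key : ∀ r ∈ Finset.range (2 ^ s), |∑ q ∈ Finset.range (2 ^ N),
      ((if ∀ k ∈ K, (k * (2 ^ (2 ^ s * 2 ^ N * c + (2 ^ s * q + r)) * d) ∈ bitSet φ σ ↔ B k = true)
        then (1 : ℝ) else 0) - (1 / 2 : ℝ) ^ K.card)|
      ≤ if r + R < 2 ^ s then 0 else (2:ℝ) ^ N := by
    intro r hr
    split_ifs with h
    · have hk2 : ∀ k ∈ K, r + k.factorization 2 < 2 ^ s := by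
        intro k hk
        have := Nat.factorization_lt 2 (hK k hk).ne'
        have := hR k hk
        omega
      have hcount := bit_count' (K := K) N c B
        (fun k => φ s (r + k.factorization 2) (k / 2 ^ k.factorization 2 * d))
        (fun k hk => hM _ _ _ (hk2 k hk)) (by
          intro k hk k' hk' he
          have pk := Nat.ordCompl_pos 2 (hK k hk).ne'
          have pk' := Nat.ordCompl_pos 2 (hK k' hk').ne'
          obtain ⟨h1, h2⟩ := hφ s _ _ _ _ d (hk2 k hk) (hk2 k' hk') hd0 pk pk'
            ((Nat.div_le_self _ _).trans_lt (hKs k hk))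
            ((Nat.div_le_self _ _).trans_lt (hKs k' hk')) he
          have h1 : k.factorization 2 = k'.factorization 2 := by omega
          rw [← Nat.ordProj_mul_ordCompl_eq_self k 2, ← Nat.ordProj_mul_ordCompl_eq_self k' 2,
            h2, h1])
      rw [Finset.sum_sub_distrib, Finset.sum_boole]
      have e : (Finset.range (2 ^ N)).filter (fun q => ∀ k ∈ K,
          (k * (2 ^ (2 ^ s * 2 ^ N * c + (2 ^ s * q + r)) * d) ∈ bitSet φ σ ↔ B k = true))
          = (Finset.range (2 ^ N)).filter (fun q => ∀ k ∈ K, ((2 ^ N * c + q).testBit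
            (φ s (r + k.factorization 2) (k / 2 ^ k.factorization 2 * d)) = true ↔ B k = true)) := by
        apply Finset.filter_congr
        intro q hq
        rw [Finset.mem_range] at hq
        refine forall₂_congr fun k hk => ?_
        rw [mem_bitSet φ σ k _ d t (2 ^ N * c + q) r (hK k hk) hd ?_ ?_ ?_ (hk2 k hk)]
        · rw [← hs, mul_add, ← mul_assoc]; omega
        · refine le_trans ?_ hc2
          rw [← hs, mul_assoc]
          apply Nat.mul_le_mul_left
          rw [mul_add]; omega
        · rw [← hs]; ring
      rw [e]
      have hcount' : _ = _ := hcount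
      rw [show (((Finset.range (2 ^ N)).filter (fun q => ∀ k ∈ K, ((2 ^ N * c + q).testBit
            (φ s (r + k.factorization 2) (k / 2 ^ k.factorization 2 * d)) = true ↔ B k = true))).card
            : ℝ) = (1 / 2 : ℝ) ^ K.card * 2 ^ N by convert hcount]
      simp [mul_comm]
    · refine (Finset.abs_sum_le_sum_abs _ _).trans ?_
      calc _ ≤ ∑ q ∈ Finset.range (2 ^ N), (1:ℝ) := by
            apply Finset.sum_le_sum
            intro q _
            have h0 : (0:ℝ) ≤ (1 / 2 : ℝ) ^ K.card := by positivity
            have h1 : (1 / 2 : ℝ) ^ K.card ≤ 1 := pow_le_one₀ (by norm_num) (by norm_num)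
            rw [abs_le]
            split_ifs <;> constructor <;> linarith
        _ = _ := by simp
  refine (Finset.sum_le_sum key).trans ?_
  rw [Finset.sum_ite, Finset.sum_const_zero, zero_add, Finset.sum_const, nsmul_eq_mul]
  gcongr
  calc _ ≤ (Finset.Ico (2 ^ s - R) (2 ^ s)).card := by
        apply Finset.card_le_card
        intro r
        simp only [Finset.mem_filter, Finset.mem_range, Finset.mem_Ico]
        omega
    _ ≤ R := by rw [Nat.card_Ico]; omega

lemma divisors_sum (L : ℕ) (hL : 0 < L) (f : ℕ → ℝ) :
    ∑ m ∈ L.divisors, f m = ∑ d ∈ (L / 2 ^ L.factorization 2).divisors,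
      ∑ a ∈ Finset.range (L.factorization 2 + 1), f (2 ^ a * d) := by
  have hcop : Nat.Coprime (2 ^ L.factorization 2) (L / 2 ^ L.factorization 2) :=
    (Nat.coprime_ordCompl Nat.prime_two hL.ne').pow_left _
  conv_lhs => rw [← Nat.ordProj_mul_ordCompl_eq_self L 2]
  rw [Nat.divisors_mul, Finset.mul_def, Finset.sum_image, Finset.sum_product_right]
  · refine Finset.sum_congr rfl fun d _ => ?_
    rw [Nat.divisors_prime_pow Nat.prime_two, Finset.sum_map]
    rfl
  · have := hcop.mul_injOn_divisors
    simpa using this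

/-- There exists a multiplicatively net-normal set `A ⊆ ℕ`: a set which is
`(F n)`-normal in `(ℕ,×)` for every nice Følner sequence `(F n)`. -/
theorem exists_net_normal_set :
    ∃ A : Set ℕ, ∀ F : ℕ → Finset ℕ, NiceFolner F → MulNormalSet F A := by
  classical
  obtain ⟨M, φ, hM, hφ⟩ := exists_code
  obtain ⟨σ, hσ, hσ'⟩ := exists_slow (fun s => s + (s + M s))
  refine ⟨bitSet φ σ, ?_⟩
  rintro F ⟨L, hL0, -, -, hLdiv, hF⟩ K - hK B
  set f : ℕ → ℝ := fun m => (if ∀ k ∈ K, (k * m ∈ bitSet φ σ ↔ B k = true)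
        then (1 : ℝ) else 0) - (1 / 2 : ℝ) ^ K.card with hf
  have hf1 : ∀ m, |f m| ≤ 1 := by
    intro m
    have h0 : (0:ℝ) ≤ (1 / 2 : ℝ) ^ K.card := by positivity
    have h1 : (1 / 2 : ℝ) ^ K.card ≤ 1 := pow_le_one₀ (by norm_num) (by norm_num)
    simp only [hf]
    rw [abs_le]
    split_ifs <;> constructor <;> linarith
  -- the one-dimensional estimate
  have one : ∀ ε : ℝ, 0 < ε → ∃ E0 : ℕ, ∀ E ≥ E0, ∀ d, ¬ 2 ∣ d →
      |∑ a ∈ Finset.range E, f (2 ^ a * d)| ≤ 3 * ε * E := by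
    intro ε hε
    set R := K.sup id
    have hR : ∀ k ∈ K, k ≤ R := fun k hk => Finset.le_sup (f := id) hk
    have hpow : Tendsto (fun t => (2:ℝ) ^ σ t) atTop atTop :=
      (tendsto_pow_atTop_atTop_of_one_lt (by norm_num)).comp hσ
    have hev : ∀ᶠ t in atTop, σ t + (σ t + M (σ t)) ≤ t ∧ R < σ t ∧ (R / ε ≤ 2 ^ σ t) ∧
        (1 / ε ≤ 2 ^ σ t) := by
      filter_upwards [hσ', hσ.eventually_gt_atTop R, hpow.eventually_ge_atTop (R / ε),
        hpow.eventually_ge_atTop (1 / ε)] with t h1 h2 h3 h4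
      exact ⟨h1, h2, h3, h4⟩
    obtain ⟨t0, ht0⟩ := eventually_atTop.1 hev
    obtain ⟨E1, hE1⟩ := exists_nat_ge ((2:ℝ) ^ t0 / ε)
    refine ⟨max (2 ^ t0) E1, fun E hE d hd => ?_⟩
    have := avg_lemma (fun a => f (2 ^ a * d)) (fun a => hf1 _) ε hε t0
      (fun t => σ t + M (σ t)) (fun t ht => by have := (ht0 t ht).1; omega)
      (fun t ht => by
        obtain ⟨h1, -, -, h4⟩ := ht0 t ht
        rw [div_le_iff₀ hε] at h4
        calc (2:ℝ) ^ (σ t + M (σ t)) = 1 * (2:ℝ) ^ (σ t + M (σ t)) := by ring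
          _ ≤ (2 ^ σ t * ε) * (2:ℝ) ^ (σ t + M (σ t)) := by gcongr
          _ = ε * 2 ^ (σ t + (σ t + M (σ t))) := by ring
          _ ≤ ε * 2 ^ t := by gcongr; norm_num)
      (fun t ht c hc1 hc2 => by
        obtain ⟨h1, h2, h3, h4⟩ := ht0 t ht
        refine (block_lemma M φ σ hM hφ K hK B d hd t R
          (fun k hk => (hR k hk).trans_lt h2) hR c hc1 hc2).trans ?_
        rw [div_le_iff₀ hε] at h3
        calc (R:ℝ) * 2 ^ M (σ t) ≤ (2 ^ σ t * ε) * 2 ^ M (σ t) := by gcongr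
          _ = _ := by ring)
      E ((le_max_left _ _).trans hE)
    refine this.trans ?_
    have h5 : (2:ℝ) ^ t0 / ε ≤ E := hE1.trans (by exact_mod_cast (le_max_right _ _).trans hE)
    rw [div_le_iff₀ hε] at h5
    linarith
  rw [Metric.tendsto_atTop]
  intro ε hε
  obtain ⟨E0, hE0⟩ := one (ε / 6) (by positivity)
  obtain ⟨n0, hn0⟩ := eventually_atTop.1 (hLdiv (2 ^ E0) (by positivity))
  refine ⟨n0, fun n hn => ?_⟩
  have hv : E0 ≤ (L n).factorization 2 :=
    (Nat.Prime.pow_dvd_iff_le_factorization Nat.prime_two (hL0 n).ne').1 (hn0 n hn)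
  rw [hF n]
  have hcard : (0:ℝ) < ((L n).divisors.card : ℝ) := by
    exact_mod_cast Finset.card_pos.2 (Nat.nonempty_divisors.2 (hL0 n).ne')
  have hsum : |∑ m ∈ (L n).divisors, f m| ≤ (ε / 2) * (L n).divisors.card := by
    have hc : ((L n).divisors.card : ℝ) = ∑ m ∈ (L n).divisors, (1:ℝ) := by simp
    rw [hc, divisors_sum _ (hL0 n), divisors_sum _ (hL0 n), Finset.mul_sum]
    refine (Finset.abs_sum_le_sum_abs _ _).trans (Finset.sum_le_sum fun d hd => ?_)
    have hd2 : ¬ 2 ∣ d := fun h =>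
      Nat.not_dvd_ordCompl Nat.prime_two (hL0 n).ne' (h.trans (Nat.dvd_of_mem_divisors hd))
    refine (hE0 _ (by omega) d hd2).trans (le_of_eq ?_)
    rw [Finset.sum_const, Finset.card_range, nsmul_eq_mul, mul_one]
    ring
  have hsum2 : ∑ m ∈ (L n).divisors, f m =
      (((L n).divisors.filter (fun m => ∀ k ∈ K, (k * m ∈ bitSet φ σ ↔ B k = true))).card : ℝ)
       - (L n).divisors.card * (1 / 2 : ℝ) ^ K.card := by
    simp only [hf]
    rw [Finset.sum_sub_distrib, Finset.sum_boole, Finset.sum_const, nsmul_eq_mul]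
  rw [Real.dist_eq]
  have : (((L n).divisors.filter (fun m => ∀ k ∈ K,
      (k * m ∈ bitSet φ σ ↔ B k = true))).card : ℝ) / (L n).divisors.card
      - (1 / 2 : ℝ) ^ K.card = (∑ m ∈ (L n).divisors, f m) / (L n).divisors.card := by
    rw [hsum2, sub_div, mul_div_cancel_left₀ _ hcard.ne']
  rw [this, abs_div, abs_of_pos hcard, div_lt_iff₀ hcard]
  have := mul_pos hε hcard
  linarith
end
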